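/- Let κ be a kernel on S and c ∈ [0,∞)^S with Σ(κ,c) ≤ 1. Then ∑_{k∈ℕ₀^S} λ_k(c) = ∑_{r∈S} c_r − (1/2) ∑_{r,s∈S} c_r κ(r,s) c_s. -/

import Mathlib

open scoped Classical ENNReal
open Filter MeasureTheory

noncomputable section

/-- The set of ordered pairs `(i,j)` of vertices with `i < j`, representing the
potential edges of a graph on `Fin n`. -/
def upperPairs (n : ℕ) : Finset (Fin n × Fin n) :=
  Finset.univ.filter fun q => q.1 < q.2

/-- The simple graph on `Fin n` determined by a finite set of (ordered) edges. -/
def graphOf {n : ℕ} (E : Finset (Fin n × Fin n)) : SimpleGraph (Fin n) :=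
  SimpleGraph.fromRel fun i j => (i, j) ∈ E

/-- `PConn n x p` is the probability that the inhomogeneous random graph `G(n, x, p)`,
with type vector `x` and independent edges where `{i,j}` is present with probability
`p (x i) (x j)`, is connected; written as a finite sum over connected graphs. -/
def PConn {S : Type*} (n : ℕ) (x : Fin n → S) (p : S → S → ℝ) : ℝ :=
  ∑ E ∈ (upperPairs n).powerset.filter (fun E => (graphOf E).Connected),
    (∏ q ∈ E, p (x q.1) (x q.2)) * ∏ q ∈ upperPairs n \ E, (1 - p (x q.1) (x q.2))

/-- Sum over all spanning trees (connected graphs with `n - 1` edges) on `Fin n` of the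
product of the kernel over the edges. -/
def treeWeight {S : Type*} (n : ℕ) (x : Fin n → S) (κ : S → S → ℝ) : ℝ :=
  ∑ E ∈ (upperPairs n).powerset.filter
      (fun E => (graphOf E).Connected ∧ E.card + 1 = n),
    ∏ q ∈ E, κ (x q.1) (x q.2)

/-- A canonical list of types compatible with the multiplicity vector `k`. -/
def compatList {S : Type*} [Fintype S] (k : S → ℕ) : List S :=
  (∑ s : S, (k s) • ({s} : Multiset S)).toList

lemma compatList_length {S : Type*} [Fintype S] (k : S → ℕ) :
    (compatList k).length = ∑ s : S, k s := by
  simp [compatList]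

/-- A canonical type vector compatible with `k`, i.e. with `∑ i δ_{x i} = k`. -/
def compatVec {S : Type*} [Fintype S] (k : S → ℕ) : Fin (∑ s : S, k s) → S :=
  fun i => (compatList k).get (Fin.cast (compatList_length k).symm i)

/-- `tau κ k` is the spanning-tree weight `τ(k; κ)`. -/
def tau {S : Type*} [Fintype S] (κ : S → S → ℝ) (k : S → ℕ) : ℝ :=
  treeWeight (∑ s : S, k s) (compatVec k) κ

/-- `pN κN N k` is the probability that the inhomogeneous random graph on a vertex set
with type composition `k` and edge probabilities `min 1 (κN/N)` is connected. -/
def pN {S : Type*} [Fintype S] (κN : S → S → ℝ) (N : ℕ) (k : S → ℕ) : ℝ :=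
  PConn (∑ s : S, k s) (compatVec k) fun r s => min 1 (κN r s / N)

/-- Extended-real logarithm, with `elog x = -∞` for `x ≤ 0`. -/
def elog (x : ℝ) : EReal := if x ≤ 0 then (⊥ : EReal) else ((Real.log x : ℝ) : EReal)

/-- The nonnegative part of `-log u`, equal to `∞` if `u ≤ 0`. -/
def negLogPart (u : ℝ) : ℝ≥0∞ := if u ≤ 0 then ⊤ else ENNReal.ofReal (-Real.log u)

/-- The relative-entropy summand `x log (x / d)` with conventions `0 log 0 = 0` and
`x log (x/0) = +∞` for `x ≠ 0`. -/
def entTerm (x d : ℝ) : EReal :=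
  if x = 0 then (0 : EReal) else if d ≤ 0 then (⊤ : EReal)
  else ((x * Real.log (x / d) : ℝ) : EReal)

/-- `‖κ‖_∞ = max_{r,s} κ r s`. -/
def kernelSup {S : Type*} [Fintype S] [Nonempty S] (κ : S → S → ℝ) : ℝ :=
  Finset.univ.sup' Finset.univ_nonempty fun r =>
    Finset.univ.sup' Finset.univ_nonempty fun s => κ r s

/-- `Σ(κ, ν)`, the `ℓ²(ν)`-operator norm of the matrix `(κ r s * ν s)_{r,s}`. -/
def sigmaOp {S : Type*} [Fintype S] (κ : S → S → ℝ) (ν : S → ℝ) : ℝ :=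
  sSup { t : ℝ | ∃ f : S → ℝ, (∀ s, 0 ≤ f s) ∧ (∑ r : S, ν r * f r ^ 2) ≤ 1 ∧
    t = Real.sqrt (∑ r : S, ν r * (∑ s : S, κ r s * f s * ν s) ^ 2) }

/-- Irreducibility of the kernel `κ` with respect to `ν`. -/
def Irred {S : Type*} (κ : S → S → ℝ) (ν : S → ℝ) : Prop :=
  ∀ A : Set S, (∀ r ∈ A, ∀ s, s ∉ A → 0 < ν r → 0 < ν s → κ r s = 0) →
    (∀ r ∈ A, ν r = 0) ∨ (∀ s, s ∉ A → ν s = 0)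

/-- The generating series `Γ_r(θ) = ∑_k τ(k) k_r ∏_s θ_s^{k_s}/k_s! ∈ [0,∞]`. -/
def Gamma0 {S : Type*} [Fintype S] (κ : S → S → ℝ) (θ : S → ℝ) (r : S) : ℝ≥0∞ :=
  ∑' k : S → ℕ,
    ENNReal.ofReal (tau κ k * (k r : ℝ) * ∏ s : S, θ s ^ (k s) / (Nat.factorial (k s) : ℝ))

/-- `χ(κ, θ)`: the infimum over probability vectors `w ≪ θ` of
`∑_r w_r log (w_r / ((κ w)_r θ_r))`. -/
def chiFn {S : Type*} [Fintype S] (κ : S → S → ℝ) (θ : S → ℝ) : EReal :=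
  sInf { v : EReal | ∃ w : S → ℝ, (∀ r, 0 ≤ w r) ∧ ((∑ r : S, w r) = 1) ∧
    (∀ r, θ r = 0 → w r = 0) ∧
    v = ∑ r : S, entTerm (w r) ((∑ s : S, κ r s * w s) * θ r) }

/-- `Δ_r(k)`: the sum over directed spanning trees of the support of `k` rooted at `r`
(encoded as parent maps `f`, edges `(f s, s)` directed away from the root) of
`∏ κ(f s, s) * k (f s)`. -/
def Delta {S : Type*} [Fintype S] [DecidableEq S] (κ : S → S → ℝ) (k : S → ℕ) (r : S) : ℝ :=
  ∑ f ∈ (Finset.univ : Finset (S → S)).filter (fun f =>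
      (∀ s, (s = r ∨ k s = 0) → f s = s) ∧
      ∀ s, 0 < k s → s ≠ r → (0 < k (f s) ∧ ∃ n, f^[n] s = r)),
    ∏ s ∈ Finset.univ.filter (fun s => 0 < k s ∧ s ≠ r), (κ (f s) s * (k (f s) : ℝ))

/-- The reference weight `τ(k) ∏_s μ_s^{k_s}/k_s!`. -/
def rhoMu {S : Type*} [Fintype S] (κ : S → S → ℝ) (μ : S → ℝ) (k : S → ℕ) : ℝ :=
  tau κ k * ∏ s : S, μ s ^ (k s) / (Nat.factorial (k s) : ℝ)

/-- The microscopic rate function `I_Mi`. -/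
def IMi {S : Type*} [Fintype S] (κ : S → S → ℝ) (μ : S → ℝ) (lam : (S → ℕ) → ℝ) : EReal :=
  (∑' k : S → ℕ, entTerm (lam k) (rhoMu κ μ k))
  + ((∑' k : S → ℕ, lam k * (((∑ s : S, k s : ℕ) : ℝ) - 1) : ℝ) : EReal)
  + ((((1 : ℝ)/2) * ∑ r : S, ∑ s : S, (∑' k : S → ℕ, lam k * (k r : ℝ)) * κ r s * μ s : ℝ) : EReal)

/-- The minimizer candidate `λ_k(c) = τ(k) ∏_s (c_s e^{-(κ c)_s})^{k_s}/k_s!`. -/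
def lamC {S : Type*} [Fintype S] (κ : S → S → ℝ) (c : S → ℝ) (k : S → ℕ) : ℝ :=
  tau κ k * ∏ s : S, (c s * Real.exp (-(∑ t : S, κ s t * c t))) ^ (k s) / (Nat.factorial (k s) : ℝ)

/-- The mesoscopic rate function `I_Me`. -/
def IMe {S : Type*} [Fintype S] (κ : S → S → ℝ) (μ ν : S → ℝ) : EReal :=
  (∑ r : S, entTerm (ν r) ((∑ s : S, κ r s * ν s) * μ r))
  + ((((1 : ℝ)/2) * ∑ r : S, ∑ s : S, ν r * κ r s * μ s : ℝ) : EReal)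

/-- `b` is a solution of the fixed-point system for `c`:
`b ∈ [0,∞)^S`, `b ≤ c` and `(κ(c-b))_r b_r = c_r - b_r` for all `r`. -/
def IsFPSol {S : Type*} [Fintype S] (κ : S → S → ℝ) (c b : S → ℝ) : Prop :=
  (∀ r, 0 ≤ b r) ∧ (∀ r, b r ≤ c r) ∧
    ∀ r, (∑ s : S, κ r s * (c s - b s)) * b r = c r - b r

/-- The macroscopic rate summand `f_Ma`. -/
def fMa {S : Type*} [Fintype S] (κ : S → S → ℝ) (μ y : S → ℝ) : EReal :=
  (∑ r : S, entTerm (y r) ((1 - Real.exp (-(∑ s : S, κ r s * y s))) * μ r))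
  + ((((1 : ℝ)/2) * ∑ r : S, ∑ s : S, y r * κ r s * (μ s - y s) : ℝ) : EReal)

/-- The functional `G_c(b)`. -/
def Gc {S : Type*} [Fintype S] (κ : S → S → ℝ) (μ c b : S → ℝ) : EReal :=
  (((∑ r : S, b r * Real.log (b r / μ r))
      - (1/2) * ∑ r : S, ∑ s : S, b r * κ r s * b s
      + (1/2) * ∑ r : S, ∑ s : S, c r * κ r s * μ s : ℝ) : EReal)
  + ∑ r : S, entTerm (c r - b r) ((∑ s : S, κ r s * (c s - b s)) * μ r)

/-- `λ_k(t) = t^{|k|-1} τ(k) e^{-t⟨k,κμ⟩} ∏_r μ_r^{k_r}/k_r!`. -/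
def lamT {S : Type*} [Fintype S] (κ : S → S → ℝ) (μ : S → ℝ) (k : S → ℕ) (t : ℝ) : ℝ :=
  t ^ ((∑ s : S, k s) - 1) * tau κ k *
    Real.exp (-t * ∑ r : S, ∑ s : S, (k r : ℝ) * κ r s * μ s) *
    ∏ r : S, μ r ^ (k r) / (Nat.factorial (k r) : ℝ)

structure IsTr {α : Type*} (V : Finset α) (E : Finset (Sym2 α)) : Prop where
  sub : E ⊆ V.sym2
  nd : ∀ e ∈ E, ¬ e.IsDiag
  ne : V.Nonempty
  conn : ∀ a ∈ V, ∀ b ∈ V, Relation.ReflTransGen (fun a b => s(a,b) ∈ E) a b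
  card : E.card + 1 = V.card

def tw {α : Type*} (V : Finset α) (w : Sym2 α → ℝ) : ℝ :=
  ∑ E ∈ V.sym2.powerset.filter (IsTr V), ∏ e ∈ E, w e

lemma crossing {α : Type*} {r : α → α → Prop} {P : α → Prop} {a b : α}
    (h : Relation.ReflTransGen r a b) (ha : P a) (hb : ¬ P b) :
    ∃ x y, P x ∧ ¬ P y ∧ r x y := by
  induction h with
  | refl => exact absurd ha hb
  | @tail b c hab hbc ih =>
    by_cases h : P b
    · exact ⟨b, c, h, hb, hbc⟩
    · exact ih h

lemma conn_card {α : Type*} {V : Finset α} {E : Finset (Sym2 α)} (hsub : E ⊆ V.sym2)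
    (hne : V.Nonempty)
    (hc : ∀ a ∈ V, ∀ b ∈ V, Relation.ReflTransGen (fun a b => s(a,b) ∈ E) a b) :
    V.card ≤ E.card + 1 := by
  obtain ⟨v, hv⟩ := hne
  have key : ∀ m : ℕ, m + 1 ≤ V.card → ∃ U ⊆ V, v ∈ U ∧ U.card = m + 1 ∧
      m ≤ (E.filter (· ∈ U.sym2)).card := by
    intro m
    induction m with
    | zero => intro _; exact ⟨{v}, by simpa using hv, by simp, by simp, by simp⟩
    | succ m ih =>
      intro hm
      obtain ⟨U, hU, hvU, hUc, hUm⟩ := ih (by omega)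
      have : ∃ b ∈ V, b ∉ U := by
        by_contra! hcon
        have := Finset.card_le_card (show V ⊆ U from hcon)
        omega
      obtain ⟨b, hb, hbU⟩ := this
      obtain ⟨x, y, hx, hy, hxy⟩ := crossing (P := (· ∈ U)) (hc v hv b hb) hvU hbU
      have hyV : y ∈ V := (Finset.mk_mem_sym2_iff.1 (hsub hxy)).2
      refine ⟨insert y U, ?_, by simp [hvU], by simp [hy, hUc], ?_⟩
      · intro z hz
        rcases Finset.mem_insert.1 hz with rfl | hz
        · exact hyV
        · exact hU hz
      · have hs : insert s(x,y) (E.filter (· ∈ U.sym2)) ⊆ E.filter (· ∈ (insert y U).sym2) := by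
          intro e he
          rcases Finset.mem_insert.1 he with rfl | he
          · simp only [Finset.mem_filter, Finset.mk_mem_sym2_iff, Finset.mem_insert]
            exact ⟨hxy, Or.inr hx, by simp⟩
          · simp only [Finset.mem_filter] at he ⊢
            exact ⟨he.1, Finset.sym2_mono (Finset.subset_insert _ _) he.2⟩
        have hn : s(x,y) ∉ E.filter (· ∈ U.sym2) := by
          simp only [Finset.mem_filter, Finset.mk_mem_sym2_iff]
          tauto
        have := Finset.card_le_card hs
        rw [Finset.card_insert_of_notMem hn] at this
        omega
  have hpos : 0 < V.card := Finset.card_pos.2 ⟨v, hv⟩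
  obtain ⟨U, _, _, _, h⟩ := key (V.card - 1) (by omega)
  have := Finset.card_le_card (Finset.filter_subset (· ∈ U.sym2) E)
  omega

/-- component of `w` avoiding `v` -/
def cmpo {α : Type*} (V : Finset α) (E : Finset (Sym2 α)) (v w : α) : Finset α :=
  V.filter fun u => Relation.ReflTransGen (fun a b => s(a,b) ∈ E ∧ a ≠ v ∧ b ≠ v) w u

lemma rtg_mono {α : Type*} {E F : Finset (Sym2 α)} (h : E ⊆ F) {a b : α}
    (hr : Relation.ReflTransGen (fun a b => s(a,b) ∈ E) a b) :
    Relation.ReflTransGen (fun a b => s(a,b) ∈ F) a b :=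
  Relation.ReflTransGen.mono (fun _ _ hh => h hh) _ _ hr

lemma rtg_symm {α : Type*} {E : Finset (Sym2 α)} {a b : α}
    (hr : Relation.ReflTransGen (fun a b => s(a,b) ∈ E) a b) :
    Relation.ReflTransGen (fun a b => s(a,b) ∈ E) b a := by
  induction hr with
  | refl => exact Relation.ReflTransGen.refl
  | tail _ h ih => exact Relation.ReflTransGen.head (by rw [Sym2.eq_swap]; exact h) ih

lemma join_tr {α : Type*} {V A : Finset α} {v a : α} {E1 E2 : Finset (Sym2 α)}
    (hA : A ⊆ V) (hv : v ∈ V) (hvA : v ∉ A) (ha : a ∈ A)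
    (h1 : IsTr A E1) (h2 : IsTr (V \ A) E2) :
    s(v,a) ∉ E1 ∧ s(v,a) ∉ E2 ∧ Disjoint E1 E2 ∧ IsTr V (insert s(v,a) (E1 ∪ E2)) := by
  have n1 : s(v,a) ∉ E1 := fun h => hvA (Finset.mk_mem_sym2_iff.1 (h1.sub h)).1
  have n2 : s(v,a) ∉ E2 := fun h =>
    (Finset.mem_sdiff.1 (Finset.mk_mem_sym2_iff.1 (h2.sub h)).2).2 ha
  have dj : Disjoint E1 E2 := by
    rw [Finset.disjoint_left]
    intro e he1 he2
    have i1 := h1.sub he1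
    have i2 := h2.sub he2
    induction e with
    | _ x y =>
      exact (Finset.mem_sdiff.1 (Finset.mk_mem_sym2_iff.1 i2).1).2 (Finset.mk_mem_sym2_iff.1 i1).1
  refine ⟨n1, n2, dj, ?_, ?_, ⟨v, hv⟩, ?_, ?_⟩
  · intro e he
    rcases Finset.mem_insert.1 he with rfl | he
    · exact Finset.mk_mem_sym2_iff.2 ⟨hv, hA ha⟩
    · rcases Finset.mem_union.1 he with he | he
      · exact Finset.sym2_mono hA (h1.sub he)
      · exact Finset.sym2_mono Finset.sdiff_subset (h2.sub he)
  · intro e he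
    rcases Finset.mem_insert.1 he with rfl | he
    · rw [Sym2.mk_isDiag_iff]; rintro rfl; exact hvA ha
    · rcases Finset.mem_union.1 he with he | he
      · exact h1.nd e he
      · exact h2.nd e he
  · have s1 : E1 ⊆ insert s(v,a) (E1 ∪ E2) :=
      Finset.subset_union_left.trans (Finset.subset_insert _ _)
    have s2 : E2 ⊆ insert s(v,a) (E1 ∪ E2) :=
      Finset.subset_union_right.trans (Finset.subset_insert _ _)
    have hvx : ∀ x ∈ V, Relation.ReflTransGen
        (fun p q => s(p,q) ∈ insert s(v,a) (E1 ∪ E2)) v x := by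
      intro x hx
      by_cases hxA : x ∈ A
      · exact Relation.ReflTransGen.head (Finset.mem_insert_self _ _)
          (rtg_mono s1 (h1.conn a ha x hxA))
      · exact rtg_mono s2 (h2.conn v (Finset.mem_sdiff.2 ⟨hv, hvA⟩) x
          (Finset.mem_sdiff.2 ⟨hx, hxA⟩))
    intro x hx y hy
    exact (rtg_symm (hvx x hx)).trans (hvx y hy)
  · rw [Finset.card_insert_of_notMem (by simp [n1, n2]), Finset.card_union_of_disjoint dj]
    have := h1.card
    have := h2.card
    have := Finset.card_sdiff_add_card_eq_card hA
    omega

lemma join_cmpo {α : Type*} {V A : Finset α} {v a w : α} {E1 E2 : Finset (Sym2 α)}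
    (hA : A ⊆ V) (hvA : v ∉ A) (hw : w ∈ A)
    (h1 : IsTr A E1) (h2 : IsTr (V \ A) E2) :
    cmpo V (insert s(v,a) (E1 ∪ E2)) v w = A := by
  ext u
  simp only [cmpo, Finset.mem_filter]
  constructor
  · rintro ⟨-, h⟩
    by_contra hu
    obtain ⟨x, y, hx, hy, hxy, hxv, hyv⟩ := crossing (P := (· ∈ A)) h hw hu
    rcases Finset.mem_insert.1 hxy with h | h
    · have := Sym2.eq_iff.1 h
      tauto
    · rcases Finset.mem_union.1 h with h | h
      · exact hy (Finset.mk_mem_sym2_iff.1 (h1.sub h)).2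
      · exact (Finset.mem_sdiff.1 (Finset.mk_mem_sym2_iff.1 (h2.sub h)).1).2 hx
  · intro hu
    refine ⟨hA hu, Relation.ReflTransGen.mono ?_ _ _ (h1.conn w hw u hu)⟩
    intro p q hpq
    have := Finset.mk_mem_sym2_iff.1 (h1.sub hpq)
    refine ⟨by simp [hpq], ?_, ?_⟩
    · rintro rfl; exact hvA this.1
    · rintro rfl; exact hvA this.2

lemma split_tr {α : Type*} {V : Finset α} {v w : α} {E : Finset (Sym2 α)}
    (hv : v ∈ V) (hw : w ∈ V) (hvw : w ≠ v) (h : IsTr V E) :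
    ∃ A ⊆ V, v ∉ A ∧ w ∈ A ∧ ∃ a ∈ A, ∃ E1 E2, IsTr A E1 ∧ IsTr (V \ A) E2 ∧
      insert s(v,a) (E1 ∪ E2) = E := by
  set A := cmpo V E v w with hAdef
  have hAV : A ⊆ V := Finset.filter_subset _ _
  have hwA : w ∈ A := Finset.mem_filter.2 ⟨hw, Relation.ReflTransGen.refl⟩
  have hvA : v ∉ A := by
    intro hh
    have := (Finset.mem_filter.1 hh).2
    obtain ⟨x, y, hx, hy, hxy⟩ := crossing (P := (· ≠ v)) this hvw (by simp)
    exact hxy.2.2 (not_not.1 hy)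
  have step : ∀ x y, x ∈ A → s(x,y) ∈ E → y ≠ v → y ∈ A := by
    intro x y hx hxy hyv
    refine Finset.mem_filter.2 ⟨(Finset.mk_mem_sym2_iff.1 (h.sub hxy)).2, ?_⟩
    refine Relation.ReflTransGen.tail (Finset.mem_filter.1 hx).2 ⟨hxy, ?_, hyv⟩
    rintro rfl; exact hvA hx
  have hvVA : v ∈ V \ A := Finset.mem_sdiff.2 ⟨hv, hvA⟩
  set E1 := E.filter (· ∈ A.sym2) with hE1
  set E2 := E.filter (· ∈ (V \ A).sym2) with hE2
  have c1 : ∀ x ∈ A, Relation.ReflTransGen (fun a b => s(a,b) ∈ E1) w x := by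
    intro x hx
    have hr := (Finset.mem_filter.1 hx).2
    clear hx
    have : x ∈ A ∧ Relation.ReflTransGen (fun a b => s(a,b) ∈ E1) w x := by
      induction hr with
      | refl => exact ⟨hwA, Relation.ReflTransGen.refl⟩
      | @tail b c _ hbc ih =>
        have hcA := step b c ih.1 hbc.1 hbc.2.2
        refine ⟨hcA, ih.2.tail ?_⟩
        exact Finset.mem_filter.2 ⟨hbc.1, Finset.mk_mem_sym2_iff.2 ⟨ih.1, hcA⟩⟩
    exact this.2
  have c2 : ∀ x ∈ V \ A, Relation.ReflTransGen (fun a b => s(a,b) ∈ E2) v x := by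
    intro x hx
    have hr := h.conn v hv x (Finset.mem_sdiff.1 hx).1
    have : x ∈ A ∨ (x ∈ V \ A ∧ Relation.ReflTransGen (fun a b => s(a,b) ∈ E2) v x) := by
      clear hx
      induction hr with
      | refl => exact Or.inr ⟨hvVA, Relation.ReflTransGen.refl⟩
      | @tail b c _ hbc ih =>
        by_cases hcA : c ∈ A
        · exact Or.inl hcA
        · right
          have hcV : c ∈ V \ A := Finset.mem_sdiff.2 ⟨(Finset.mk_mem_sym2_iff.1 (h.sub hbc)).2, hcA⟩
          refine ⟨hcV, ?_⟩
          rcases ih with hb | ⟨hb, hr⟩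
          · have : c = v := by
              by_contra hne
              exact hcA (step b c hb hbc hne)
            rw [this]
          · exact hr.tail (Finset.mem_filter.2 ⟨hbc, Finset.mk_mem_sym2_iff.2 ⟨hb, hcV⟩⟩)
    rcases this with hxA | hh
    · exact absurd hxA (Finset.mem_sdiff.1 hx).2
    · exact hh.2
  obtain ⟨x, a, hx, ha, hxa⟩ := crossing (P := (· ∉ A)) (h.conn v hv w hw) hvA (by simpa using hwA)
  have ha : a ∈ A := not_not.1 ha
  have hxv : x = v := by
    by_contra hne
    exact hx (step a x ha (by rw [Sym2.eq_swap]; exact hxa) hne)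
  subst hxv
  have cc1 : ∀ p ∈ A, ∀ q ∈ A, Relation.ReflTransGen (fun a b => s(a,b) ∈ E1) p q :=
    fun p hp q hq => (rtg_symm (c1 p hp)).trans (c1 q hq)
  have cc2 : ∀ p ∈ V \ A, ∀ q ∈ V \ A, Relation.ReflTransGen (fun a b => s(a,b) ∈ E2) p q :=
    fun p hp q hq => (rtg_symm (c2 p hp)).trans (c2 q hq)
  have s1 : E1 ⊆ A.sym2 := fun e he => (Finset.mem_filter.1 he).2
  have s2 : E2 ⊆ (V \ A).sym2 := fun e he => (Finset.mem_filter.1 he).2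
  have k1 := conn_card s1 ⟨w, hwA⟩ cc1
  have k2 := conn_card s2 ⟨x, hvVA⟩ cc2
  have n1 : s(x,a) ∉ E1 := fun h => hvA (Finset.mk_mem_sym2_iff.1 (s1 h)).1
  have n2 : s(x,a) ∉ E2 := fun h =>
    (Finset.mem_sdiff.1 (Finset.mk_mem_sym2_iff.1 (s2 h)).2).2 ha
  have dj : Disjoint E1 E2 := by
    rw [Finset.disjoint_left]
    intro e he1 he2
    have i1 := s1 he1
    have i2 := s2 he2
    induction e with
    | _ x y =>
      exact (Finset.mem_sdiff.1 (Finset.mk_mem_sym2_iff.1 i2).1).2 (Finset.mk_mem_sym2_iff.1 i1).1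
  have hsubE : insert s(x,a) (E1 ∪ E2) ⊆ E := by
    intro e he
    rcases Finset.mem_insert.1 he with rfl | he
    · exact hxa
    · rcases Finset.mem_union.1 he with he | he
      · exact (Finset.mem_filter.1 he).1
      · exact (Finset.mem_filter.1 he).1
  have hcard : (insert s(x,a) (E1 ∪ E2)).card = E1.card + E2.card + 1 := by
    rw [Finset.card_insert_of_notMem (by simp [n1, n2]), Finset.card_union_of_disjoint dj]
  have hle := Finset.card_le_card hsubE
  have hVA := Finset.card_sdiff_add_card_eq_card hAV
  have hE := h.card
  refine ⟨A, hAV, hvA, hwA, a, ha, E1, E2, ?_, ?_, ?_⟩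
  · exact ⟨s1, fun e he => h.nd e (Finset.mem_filter.1 he).1, ⟨w, hwA⟩, cc1, by omega⟩
  · exact ⟨s2, fun e he => h.nd e (Finset.mem_filter.1 he).1, ⟨x, hvVA⟩, cc2, by omega⟩
  · exact Finset.eq_of_subset_of_card_le hsubE (by omega)
lemma tw_rec {α : Type*} {V : Finset α} {v w : α} (hv : v ∈ V) (hw : w ∈ V) (hvw : w ≠ v)
    (W : Sym2 α → ℝ) :
    tw V W = ∑ A ∈ (V.erase v).powerset.filter (w ∈ ·),
      (∑ a ∈ A, W s(v,a)) * tw A W * tw (V \ A) W := by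
  have e : ∀ A : Finset α, (∑ a ∈ A, W s(v,a)) * tw A W * tw (V \ A) W =
      ∑ a ∈ A, ∑ E1 ∈ A.sym2.powerset.filter (IsTr A),
        ∑ E2 ∈ (V \ A).sym2.powerset.filter (IsTr (V \ A)),
        W s(v,a) * (∏ e ∈ E1, W e) * ∏ e ∈ E2, W e := by
    intro A
    simp only [tw]
    rw [Finset.sum_mul, Finset.sum_mul]
    refine Finset.sum_congr rfl fun a _ => ?_
    rw [Finset.mul_sum, Finset.sum_comm]
    refine Finset.sum_congr rfl fun E1 _ => ?_
    rw [Finset.mul_sum, Finset.sum_mul]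
  simp only [e, Finset.sum_sigma']
  symm
  refine Finset.sum_bij (fun p _ => insert s(v,p.2.1) (p.2.2.1 ∪ p.2.2.2)) ?_ ?_ ?_ ?_
  · rintro ⟨A, a, E1, E2⟩ hp
    simp only [Finset.mem_sigma, Finset.mem_filter, Finset.mem_powerset,
      Finset.subset_erase] at hp
    obtain ⟨⟨⟨hA, hvA⟩, hwA⟩, ha, ⟨-, h1⟩, -, h2⟩ := hp
    have := (join_tr hA hv hvA ha h1 h2).2.2.2
    exact Finset.mem_filter.2 ⟨Finset.mem_powerset.2 this.sub, this⟩
  · rintro ⟨A, a, E1, E2⟩ hp ⟨A', a', E1', E2'⟩ hp' heq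
    simp only [Finset.mem_sigma, Finset.mem_filter, Finset.mem_powerset,
      Finset.subset_erase] at hp hp'
    obtain ⟨⟨⟨hA, hvA⟩, hwA⟩, ha, ⟨-, h1⟩, -, h2⟩ := hp
    obtain ⟨⟨⟨hA', hvA'⟩, hwA'⟩, ha', ⟨-, h1'⟩, -, h2'⟩ := hp'
    simp only at heq
    have hAA : A = A' := by
      rw [← join_cmpo (a := a) hA hvA hwA h1 h2, ← join_cmpo (a := a') hA' hvA' hwA' h1' h2', heq]
    subst hAA
    have e1 : ∀ {a : α} {E1 E2 : Finset (Sym2 α)}, a ∈ A → IsTr A E1 → IsTr (V \ A) E2 →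
        (insert s(v,a) (E1 ∪ E2)).filter (· ∈ A.sym2) = E1 := by
      intro a E1 E2 ha h1 h2
      ext e
      simp only [Finset.mem_filter, Finset.mem_insert, Finset.mem_union]
      constructor
      · rintro ⟨rfl | h | h, h'⟩
        · exact absurd (Finset.mk_mem_sym2_iff.1 h').1 hvA
        · exact h
        · have := h2.sub h
          induction e with
          | _ x y =>
            exact absurd (Finset.mk_mem_sym2_iff.1 h').1
              (Finset.mem_sdiff.1 (Finset.mk_mem_sym2_iff.1 this).1).2
      · intro h; exact ⟨Or.inr (Or.inl h), h1.sub h⟩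
    have e2 : ∀ {a : α} {E1 E2 : Finset (Sym2 α)}, a ∈ A → IsTr A E1 → IsTr (V \ A) E2 →
        (insert s(v,a) (E1 ∪ E2)).filter (· ∈ (V \ A).sym2) = E2 := by
      intro a E1 E2 ha h1 h2
      ext e
      simp only [Finset.mem_filter, Finset.mem_insert, Finset.mem_union]
      constructor
      · rintro ⟨rfl | h | h, h'⟩
        · exact absurd ha (Finset.mem_sdiff.1 (Finset.mk_mem_sym2_iff.1 h').2).2
        · have := h1.sub h
          induction e with
          | _ x y =>
            exact absurd (Finset.mk_mem_sym2_iff.1 this).1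
              (Finset.mem_sdiff.1 (Finset.mk_mem_sym2_iff.1 h').1).2
        · exact h
      · intro h; exact ⟨Or.inr (Or.inr h), h2.sub h⟩
    have hE1 : E1 = E1' := by rw [← e1 ha h1 h2, heq, e1 ha' h1' h2']
    have hE2 : E2 = E2' := by rw [← e2 ha h1 h2, heq, e2 ha' h1' h2']
    subst hE1 hE2
    have haa : a = a' := by
      have hj := join_tr hA hv hvA ha h1 h2
      have : s(v,a) ∈ insert s(v,a') (E1 ∪ E2) := by rw [← heq]; simp
      rcases Finset.mem_insert.1 this with h | h
      · have := Sym2.eq_iff.1 h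
        rcases this with h | h
        · exact h.2
        · exact h.2.trans h.1
      · rcases Finset.mem_union.1 h with h | h
        · exact absurd h hj.1
        · exact absurd h hj.2.1
    subst haa
    rfl
  · intro E hE
    have hT := (Finset.mem_filter.1 hE).2
    obtain ⟨A, hA, hvA, hwA, a, ha, E1, E2, h1, h2, h⟩ := split_tr hv hw hvw hT
    refine ⟨⟨A, a, E1, E2⟩, ?_, h⟩
    simp only [Finset.mem_sigma, Finset.mem_filter, Finset.mem_powerset,
      Finset.subset_erase]
    exact ⟨⟨⟨hA, hvA⟩, hwA⟩, ha, ⟨h1.sub, h1⟩, h2.sub, h2⟩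
  · rintro ⟨A, a, E1, E2⟩ hp
    simp only [Finset.mem_sigma, Finset.mem_filter, Finset.mem_powerset,
      Finset.subset_erase] at hp
    obtain ⟨⟨⟨hA, hvA⟩, hwA⟩, ha, ⟨-, h1⟩, -, h2⟩ := hp
    obtain ⟨n1, n2, dj, -⟩ := join_tr hA hv hvA ha h1 h2
    rw [Finset.prod_insert (by simp [n1, n2]), Finset.prod_union dj, mul_assoc]

lemma tw_rec2 {α : Type*} {V : Finset α} {v : α} (hv : v ∈ V) (W : Sym2 α → ℝ) :
    ((V.card : ℝ) - 1) * tw V W = ∑ A ∈ (V.erase v).powerset,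
      (A.card : ℝ) * ((∑ a ∈ A, W s(v,a)) * tw A W * tw (V \ A) W) := by
  have h1 : ∑ w ∈ V.erase v, tw V W = ((V.card : ℝ) - 1) * tw V W := by
    rw [Finset.sum_const, Finset.card_erase_of_mem hv, nsmul_eq_mul, Nat.cast_sub]
    · simp
    · exact Finset.card_pos.2 ⟨v, hv⟩
  rw [← h1]
  rw [Finset.sum_congr rfl (fun w hw => tw_rec hv (Finset.mem_of_mem_erase hw)
    (Finset.ne_of_mem_erase hw) W)]
  simp only [Finset.sum_filter]
  rw [Finset.sum_comm]
  refine Finset.sum_congr rfl fun A hA => ?_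
  rw [← Finset.sum_filter, Finset.sum_const, nsmul_eq_mul]
  congr 3
  ext w
  simp only [Finset.mem_filter, Finset.mem_powerset] at hA ⊢
  exact ⟨fun h => h.2, fun h => ⟨hA h, h⟩⟩

lemma tr_map {α β : Type*} {V : Finset α} {V' : Finset β} {E : Finset (Sym2 α)}
    (f : α → β) (hf : ∀ a ∈ V, f a ∈ V') (g : β → α) (hg : ∀ b ∈ V', g b ∈ V)
    (hgf : ∀ a ∈ V, g (f a) = a) (hfg : ∀ b ∈ V', f (g b) = b) (h : IsTr V E) :
    IsTr V' (E.image (Sym2.map f)) ∧ (E.image (Sym2.map f)).image (Sym2.map g) = E ∧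
      Set.InjOn (Sym2.map f) E := by
  have gfe : ∀ e ∈ E, Sym2.map g (Sym2.map f e) = e := by
    intro e he
    have := h.sub he
    induction e with
    | _ x y =>
      have := Finset.mk_mem_sym2_iff.1 this
      simp [hgf x this.1, hgf y this.2]
  have inj : Set.InjOn (Sym2.map f) E := by
    intro e he e' he' hh
    rw [← gfe e he, ← gfe e' he', hh]
  have hV : V' = V.image f := by
    ext b
    simp only [Finset.mem_image]
    exact ⟨fun hb => ⟨g b, hg b hb, hfg b hb⟩, by rintro ⟨a, ha, rfl⟩; exact hf a ha⟩
  have finj : Set.InjOn f V := by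
    intro a ha b hb hh
    rw [← hgf a ha, ← hgf b hb, hh]
  refine ⟨⟨?_, ?_, ?_, ?_, ?_⟩, ?_, inj⟩
  · intro e he
    obtain ⟨e, he2, rfl⟩ := Finset.mem_image.1 he
    have := h.sub he2
    induction e with
    | _ x y =>
      have := Finset.mk_mem_sym2_iff.1 this
      exact Finset.mk_mem_sym2_iff.2 ⟨hf x this.1, hf y this.2⟩
  · intro e he
    obtain ⟨e, he2, rfl⟩ := Finset.mem_image.1 he
    have := h.sub he2
    have := h.nd e he2
    induction e with
    | _ x y =>
      have h2 := Finset.mk_mem_sym2_iff.1 (h.sub he2)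
      simp only [Sym2.map_mk, Sym2.mk_isDiag_iff] at this ⊢
      exact fun hh => this (finj h2.1 h2.2 hh)
  · rw [hV]; exact h.ne.image f
  · intro a ha b hb
    rw [← hfg a ha, ← hfg b hb]
    refine Relation.ReflTransGen.lift f ?_ _ _ (h.conn _ (hg a ha) _ (hg b hb))
    intro x y hxy
    exact Finset.mem_image.2 ⟨_, hxy, rfl⟩
  · rw [Finset.card_image_of_injOn inj, hV, Finset.card_image_of_injOn finj, h.card]
  · rw [Finset.image_image]
    ext e
    simp only [Finset.mem_image, Function.comp]
    constructor
    · rintro ⟨e', he', rfl⟩; rw [gfe e' he']; exact he'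
    · intro he; exact ⟨e, he, gfe e he⟩

lemma tw_map {α β : Type*} {V : Finset α} {V' : Finset β} 
    (f : α → β) (hf : ∀ a ∈ V, f a ∈ V') (g : β → α) (hg : ∀ b ∈ V', g b ∈ V)
    (hgf : ∀ a ∈ V, g (f a) = a) (hfg : ∀ b ∈ V', f (g b) = b)
    (W : Sym2 α → ℝ) (W' : Sym2 β → ℝ) (hW : ∀ e ∈ V.sym2, W e = W' (Sym2.map f e)) :
    tw V W = tw V' W' := by
  unfold tw
  refine Finset.sum_bij' (fun E _ => E.image (Sym2.map f)) (fun E _ => E.image (Sym2.map g))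
    ?_ ?_ ?_ ?_ ?_
  · intro E hE
    have := (tr_map f hf g hg hgf hfg (Finset.mem_filter.1 hE).2).1
    exact Finset.mem_filter.2 ⟨Finset.mem_powerset.2 this.sub, this⟩
  · intro E hE
    have := (tr_map g hg f hf hfg hgf (Finset.mem_filter.1 hE).2).1
    exact Finset.mem_filter.2 ⟨Finset.mem_powerset.2 this.sub, this⟩
  · intro E hE
    exact (tr_map f hf g hg hgf hfg (Finset.mem_filter.1 hE).2).2.1
  · intro E hE
    exact (tr_map g hg f hf hfg hgf (Finset.mem_filter.1 hE).2).2.1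
  · intro E hE
    rw [Finset.prod_image (tr_map f hf g hg hgf hfg (Finset.mem_filter.1 hE).2).2.2]
    exact Finset.prod_congr rfl fun e he => hW e ((Finset.mem_filter.1 hE).2.sub he)

def cnt {α S : Type*} (x : α → S) (V : Finset α) (s : S) : ℕ := (V.filter (x · = s)).card

lemma tw_cnt {α β S : Type*} (K : Sym2 S → ℝ) {V : Finset α} {V' : Finset β} 
    (x : α → S) (x' : β → S) (h : ∀ s, cnt x V s = cnt x' V' s) :
    tw V (fun e => K (e.map x)) = tw V' (fun e => K (e.map x')) := by
  by_cases hV : V = ∅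
  · have hV' : V' = ∅ := by
      by_contra hne
      obtain ⟨b, hb⟩ := Finset.nonempty_iff_ne_empty.2 hne
      have := h (x' b)
      simp only [cnt, hV] at this
      have h2 : 0 < (V'.filter (x' · = x' b)).card :=
        Finset.card_pos.2 ⟨b, Finset.mem_filter.2 ⟨hb, rfl⟩⟩
      simp only [Finset.filter_empty, Finset.card_empty] at this
      omega
    have : ∀ {γ : Type _} (W : Sym2 γ → ℝ), tw (∅ : Finset γ) W = 0 := by
      intro γ W
      unfold tw
      rw [Finset.sum_eq_zero]
      intro E hE
      exact absurd (Finset.mem_filter.1 hE).2.ne (by simp)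
    have t2 : ∀ {γ : Type _} (W : Sym2 γ → ℝ), tw (∅ : Finset γ) W = 0 := by
      intro γ W
      unfold tw
      rw [Finset.sum_eq_zero]
      intro E hE
      exact absurd (Finset.mem_filter.1 hE).2.ne (by simp)
    subst hV hV'
    rw [this, t2]
  · obtain ⟨a0, ha0⟩ := Finset.nonempty_iff_ne_empty.2 hV
    have eq : ∀ s, Nonempty ((V.filter (x · = s)) ≃ (V'.filter (x' · = s))) :=
      fun s => ⟨Finset.equivOfCardEq (h s)⟩
    let e := fun s => (eq s).some
    have m1 : ∀ a, a ∈ V → a ∈ V.filter (x · = x a) := fun a ha => Finset.mem_filter.2 ⟨ha, rfl⟩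
    have m2 : ∀ a, a ∈ V' → a ∈ V'.filter (x' · = x' a) := fun a ha => Finset.mem_filter.2 ⟨ha, rfl⟩
    let b0 : β := e _ ⟨a0, m1 a0 ha0⟩
    let f : α → β := fun a => if ha : a ∈ V then e (x a) ⟨a, m1 a ha⟩ else b0
    let g : β → α := fun b => if hb : b ∈ V' then (e (x' b)).symm ⟨b, m2 b hb⟩ else a0
    have f1 : ∀ a (ha : a ∈ V), f a = e (x a) ⟨a, m1 a ha⟩ := fun a ha => by simp [f, ha]
    have g1 : ∀ b (hb : b ∈ V'), g b = (e (x' b)).symm ⟨b, m2 b hb⟩ := fun a ha => by simp [g, ha]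
    have f2 : ∀ a ∈ V, f a ∈ V' ∧ x' (f a) = x a := by
      intro a ha
      rw [f1 a ha]
      exact Finset.mem_filter.1 (e (x a) ⟨a, m1 a ha⟩).2
    have g2 : ∀ b ∈ V', g b ∈ V ∧ x (g b) = x' b := by
      intro a ha
      rw [g1 a ha]
      exact Finset.mem_filter.1 ((e (x' a)).symm ⟨a, m2 a ha⟩).2
    have f3 : ∀ s a (ha : a ∈ V.filter (x · = s)), f a = e s ⟨a, ha⟩ := by
      intro s a ha
      obtain ⟨ha1, rfl⟩ := Finset.mem_filter.1 ha
      exact f1 a ha1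
    have g3 : ∀ s b (hb : b ∈ V'.filter (x' · = s)), g b = (e s).symm ⟨b, hb⟩ := by
      intro s a ha
      obtain ⟨ha1, rfl⟩ := Finset.mem_filter.1 ha
      exact g1 a ha1
    refine tw_map f (fun a ha => (f2 a ha).1) g (fun b hb => (g2 b hb).1) ?_ ?_ _ _ ?_
    · intro a ha
      rw [g3 (x a) (f a) (Finset.mem_filter.2 (f2 a ha))]
      simp [f1 a ha]
    · intro a ha
      rw [f3 (x' a) (g a) (Finset.mem_filter.2 (g2 a ha))]
      simp [g1 a ha]
    · intro p hp
      induction p with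
      | _ y z =>
        have := Finset.mk_mem_sym2_iff.1 hp
        simp [(f2 y this.1).2, (f2 z this.2).2]

lemma treeWeight_eq {S : Type*} (κ : S → S → ℝ) (K : Sym2 S → ℝ) (hK : ∀ r s, K s(r,s) = κ r s)
    (n : ℕ) (x : Fin n → S) :
    treeWeight n x κ = tw Finset.univ (fun e => K (e.map x)) := by
  unfold treeWeight tw
  have lt : ∀ {E : Finset (Fin n × Fin n)}, E ⊆ upperPairs n → ∀ p q, (p,q) ∈ E → p < q := by
    intro E hE p q h
    have := hE h
    simpa [upperPairs] using this
  have inj : ∀ {E : Finset (Fin n × Fin n)}, E ⊆ upperPairs n →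
      Set.InjOn (fun q : Fin n × Fin n => s(q.1,q.2)) E := by
    rintro E hE ⟨p, q⟩ h ⟨p', q'⟩ h' hh
    have l1 := lt hE _ _ h
    have l2 := lt hE _ _ h'
    rcases Sym2.eq_iff.1 hh with ⟨h1, h2⟩ | ⟨h1, h2⟩
    · simp only at h1 h2; rw [h1, h2]
    · simp only at h1 h2
      subst h1 h2
      exact absurd l1 (not_lt.2 l2.le)
  have adj : ∀ {E : Finset (Fin n × Fin n)}, E ⊆ upperPairs n → ∀ p q, (graphOf E).Adj p q ↔
      s(p,q) ∈ E.image (fun q : Fin n × Fin n => s(q.1,q.2)) := by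
    intro E hE p q
    simp only [graphOf, SimpleGraph.fromRel_adj, Finset.mem_image, Prod.exists, Sym2.eq_iff]
    constructor
    · rintro ⟨_, h | h⟩
      · exact ⟨p, q, h, by simp⟩
      · exact ⟨q, p, h, by simp⟩
    · rintro ⟨a, b, h, ⟨rfl, rfl⟩ | ⟨rfl, rfl⟩⟩
      · exact ⟨(lt hE _ _ h).ne, Or.inl h⟩
      · exact ⟨(lt hE _ _ h).ne', Or.inr h⟩
  have conn : ∀ {E : Finset (Fin n × Fin n)}, E ⊆ upperPairs n → ∀ p q,
      (graphOf E).Reachable p q ↔ Relation.ReflTransGen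
        (fun p q => s(p,q) ∈ E.image (fun q : Fin n × Fin n => s(q.1,q.2))) p q := by
    intro E hE p q
    rw [SimpleGraph.reachable_iff_reflTransGen]
    have : (graphOf E).Adj = 
        (fun p q => s(p,q) ∈ E.image (fun q : Fin n × Fin n => s(q.1,q.2))) := by
      ext p q; exact adj hE p q
    rw [this]
  have back : ∀ F : Finset (Sym2 (Fin n)), (∀ e ∈ F, ¬ e.IsDiag) →
      ((upperPairs n).filter (fun q => s(q.1,q.2) ∈ F)).image
        (fun q : Fin n × Fin n => s(q.1,q.2)) = F := by
    intro F hF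
    ext e
    simp only [Finset.mem_image, Finset.mem_filter]
    constructor
    · rintro ⟨q, hq, rfl⟩; exact hq.2
    · intro he
      have := hF e he
      induction e with
      | _ p q =>
        rw [Sym2.mk_isDiag_iff] at this
        rcases lt_or_gt_of_ne this with h | h
        · exact ⟨(p,q), ⟨by simp [upperPairs, h], he⟩, rfl⟩
        · exact ⟨(q,p), ⟨by simp [upperPairs, h], by rw [Sym2.eq_swap]; exact he⟩, Sym2.eq_swap⟩
  refine Finset.sum_bij' (fun E _ => E.image (fun q : Fin n × Fin n => s(q.1,q.2)))
    (fun F _ => (upperPairs n).filter (fun q => s(q.1,q.2) ∈ F)) ?_ ?_ ?_ ?_ ?_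
  · intro E hE
    obtain ⟨h1, h2, h3⟩ := Finset.mem_filter.1 hE
    rw [Finset.mem_powerset] at h1
    have hne := h2.nonempty
    refine Finset.mem_filter.2 ⟨by simp [Finset.sym2_univ], by simp [Finset.sym2_univ], ?_, 
      Finset.univ_nonempty, ?_, ?_⟩
    · intro e he
      obtain ⟨⟨p, q⟩, h, rfl⟩ := Finset.mem_image.1 he
      rw [Sym2.mk_isDiag_iff]
      exact (lt h1 _ _ h).ne
    · intro p _ q _
      exact (conn h1 p q).1 (h2.preconnected p q)
    · rw [Finset.card_image_of_injOn (inj h1), h3]; simp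
  · intro F hF
    have hT := (Finset.mem_filter.1 hF).2
    have hs : (upperPairs n).filter (fun q => s(q.1,q.2) ∈ F) ⊆ upperPairs n :=
      Finset.filter_subset _ _
    refine Finset.mem_filter.2 ⟨Finset.mem_powerset.2 hs, ?_, ?_⟩
    · have : Nonempty (Fin n) := ⟨hT.ne.choose⟩
      refine ⟨fun p q => ?_⟩
      rw [conn hs, back F hT.nd]
      exact hT.conn p (by simp) q (by simp)
    · rw [← Finset.card_image_of_injOn (inj hs), back F hT.nd, hT.card]; simp
  · intro E hE
    have h1 := Finset.mem_powerset.1 (Finset.mem_filter.1 hE).1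
    ext ⟨p, q⟩
    simp only [Finset.mem_filter]
    constructor
    · rintro ⟨h, h'⟩
      have := ((adj h1 p q).2 h').2
      rcases this with h2 | h2
      · exact h2
      · exact absurd (lt h1 _ _ h2) (not_lt.2 (by simp [upperPairs] at h; exact h.le))
    · intro h; exact ⟨h1 h, Finset.mem_image.2 ⟨_, h, rfl⟩⟩
  · intro F hF
    exact back F (Finset.mem_filter.1 hF).2.nd
  · intro E hE
    have h1 := Finset.mem_powerset.1 (Finset.mem_filter.1 hE).1
    rw [Finset.prod_image (inj h1)]
    simp [hK]
lemma cnt_compatVec {S : Type*} [Fintype S] (k : S → ℕ) (s : S) :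
    cnt (compatVec k) Finset.univ s = k s := by
  have h1 : cnt (compatVec k) Finset.univ s =
      Multiset.count s (Finset.univ.val.map (compatVec k)) := by
    rw [Multiset.count_map]
    simp only [cnt, Finset.card_def, Finset.filter_val, eq_comm]
  have h2 : (Finset.univ.val.map (compatVec k)) = ((compatList k : List S) : Multiset S) := by
    rw [Fin.univ_val_map]
    congr 1
    apply List.ext_get
    · simp [compatList_length]
    · intro n h1 h2
      simp [compatVec]
  rw [h1, h2, compatList, Multiset.coe_toList, Multiset.count_sum']
  simp [Multiset.count_singleton]

lemma tw_tau {S α : Type*} [Fintype S] (κ : S → S → ℝ) (K : Sym2 S → ℝ)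
    (hK : ∀ r s, K s(r,s) = κ r s) (x : α → S) (V : Finset α) :
    tw V (fun e => K (e.map x)) = tau κ (cnt x V) := by
  unfold tau
  rw [treeWeight_eq κ K hK]
  exact tw_cnt K x _ fun s => (cnt_compatVec _ s).symm

lemma sum_cnt {S α : Type*} [Fintype S] (x : α → S) (V : Finset α) :
    ∑ s, cnt x V s = V.card :=
  (Finset.card_eq_sum_card_fiberwise (f := x) (t := Finset.univ) (by intro a _; simp)).symm

lemma card_cnt {S α : Type*} [Fintype S] (x : α → S) (V : Finset α) (l : S → ℕ) :
    (V.powerset.filter (fun A => cnt x A = l)).card = ∏ s, (cnt x V s).choose (l s) := by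
  have : ∏ s, (cnt x V s).choose (l s) =
      (Fintype.piFinset fun s => (V.filter (x · = s)).powersetCard (l s)).card := by
    simp [Fintype.card_piFinset, cnt]
  rw [this]
  refine Finset.card_bij' (fun A _ s => A.filter (x · = s))
    (fun B _ => V.filter (fun a => a ∈ B (x a))) ?_ ?_ ?_ ?_
  · intro A hA
    obtain ⟨h1, h2⟩ := Finset.mem_filter.1 hA
    rw [Finset.mem_powerset] at h1
    rw [Fintype.mem_piFinset]
    intro s
    rw [Finset.mem_powersetCard]
    exact ⟨Finset.filter_subset_filter _ h1, congrFun h2 s⟩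
  · intro B hB
    rw [Fintype.mem_piFinset] at hB
    refine Finset.mem_filter.2 ⟨Finset.mem_powerset.2 (Finset.filter_subset _ _), ?_⟩
    ext s
    obtain ⟨h1, h2⟩ := Finset.mem_powersetCard.1 (hB s)
    rw [← h2]
    unfold cnt
    congr 1
    ext a
    simp only [Finset.mem_filter]
    constructor
    · rintro ⟨⟨_, h⟩, rfl⟩; exact h
    · intro h
      obtain ⟨h3, rfl⟩ := Finset.mem_filter.1 (h1 h)
      exact ⟨⟨h3, h⟩, rfl⟩
  · intro A hA
    obtain ⟨h1, h2⟩ := Finset.mem_filter.1 hA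
    rw [Finset.mem_powerset] at h1
    ext a
    simp only [Finset.mem_filter, and_true]
    exact ⟨fun h => h.2, fun h => ⟨h1 h, h⟩⟩
  · intro B hB
    rw [Fintype.mem_piFinset] at hB
    ext s a
    obtain ⟨h1, h2⟩ := Finset.mem_powersetCard.1 (hB s)
    simp only [Finset.mem_filter]
    constructor
    · rintro ⟨⟨_, h⟩, rfl⟩; exact h
    · intro h
      obtain ⟨h3, rfl⟩ := Finset.mem_filter.1 (h1 h)
      exact ⟨⟨h3, h⟩, rfl⟩

lemma sum_powerset_cnt {S α : Type*} [Fintype S] (x : α → S) (V : Finset α)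
    (I : Finset (S → ℕ)) (hI : ∀ A ⊆ V, cnt x A ∈ I) (F : (S → ℕ) → ℝ) :
    ∑ A ∈ V.powerset, F (cnt x A) = ∑ l ∈ I, (∏ s, ((cnt x V s).choose (l s) : ℝ)) * F l := by
  rw [← Finset.sum_fiberwise_of_maps_to (t := I) (g := cnt x)
    (fun A hA => hI A (Finset.mem_powerset.1 hA))]
  refine Finset.sum_congr rfl fun l _ => ?_
  rw [Finset.sum_congr rfl (g := fun _ => F l)
    (fun A hA => by rw [(Finset.mem_filter.1 hA).2])]
  rw [Finset.sum_const, card_cnt, nsmul_eq_mul]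
  push_cast
  rfl

lemma tau_rec_gen {S α : Type*} [Fintype S] (κ : S → S → ℝ) (hκsym : ∀ r s, κ r s = κ s r)
    (k : S → ℕ) (r : S) (V : Finset α) (x : α → S) (hcu : cnt x V = k) (v : α) (hvV : v ∈ V)
    (hv : x v = r) :
    ((∑ s, (k s : ℝ)) - 1) * tau κ k = ∑ l ∈ Finset.Iic k,
      (∏ s, ((k s - if s = r then 1 else 0).choose (l s) : ℝ)) *
      ((∑ s, (l s : ℝ)) * ((∑ s, κ r s * l s) * tau κ l * tau κ (k - l))) := by
  let K : Sym2 S → ℝ := Sym2.lift ⟨κ, hκsym⟩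
  have hK : ∀ r s, K s(r,s) = κ r s := fun r s => by simp [K]
  have hc : cnt x (V.erase v) = fun s => k s - if s = r then 1 else 0 := by
    ext s
    rw [← congrFun hcu s]
    unfold cnt
    rw [Finset.filter_erase]
    split_ifs with h
    · rw [Finset.card_erase_of_mem (by simp [hv, h, hvV])]
    · rw [Finset.erase_eq_of_notMem (by simp [hv]; exact fun _ h' => h h'.symm)]; simp
  have main := tw_rec2 hvV (fun e => K (e.map x))
  have mono : ∀ {A B : Finset α}, A ⊆ B → cnt x A ≤ cnt x B := by
    intro A B hAB s
    exact Finset.card_le_card (Finset.filter_subset_filter _ hAB)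
  have hsum : ∀ A : Finset α, ∑ a ∈ A, K (Sym2.map x s(v,a)) =
      ∑ s, κ r s * (cnt x A s : ℝ) := by
    intro A
    simp only [Sym2.map_mk, hK, hv]
    rw [← Finset.sum_fiberwise (s := A) (g := x)]
    refine Finset.sum_congr rfl fun s _ => ?_
    rw [Finset.sum_congr rfl (g := fun _ => κ r s)
      (fun a ha => by rw [(Finset.mem_filter.1 ha).2])]
    rw [Finset.sum_const, nsmul_eq_mul, mul_comm]
    rfl
  have hsd : ∀ A : Finset α, A ⊆ V → cnt x (V \ A) = k - cnt x A := by
    intro A hA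
    ext s
    rw [Pi.sub_apply, ← congrFun hcu s]
    unfold cnt
    have h1 : V.filter (x · = s) = (A.filter (x · = s)) ∪
        ((V \ A).filter (x · = s)) := by
      rw [← Finset.filter_union, Finset.union_sdiff_of_subset hA]
    rw [h1, Finset.card_union_of_disjoint]
    · omega
    · rw [Finset.disjoint_left]; intro a ha hb
      simp at ha hb; tauto
  have hcard : ∀ A : Finset α, (A.card : ℝ) = ∑ s, (cnt x A s : ℝ) := by
    intro A; rw [← sum_cnt x A]; push_cast; rfl
  simp only [tw_tau κ K hK, hcu, hsum, hcard] at main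
  rw [main]
  refine Eq.trans (Finset.sum_congr rfl fun A hA => ?_)
    ((sum_powerset_cnt x (V.erase v) (Finset.Iic k) 
    (fun A hA => by
      rw [Finset.mem_Iic, ← hcu]; exact mono (hA.trans (Finset.erase_subset _ _)))
    (fun l => (∑ s, (l s : ℝ)) * ((∑ s, κ r s * l s) * tau κ l * tau κ (k - l)))).trans ?_)
  · rw [hsd A ((Finset.mem_powerset.1 hA).trans (Finset.erase_subset _ _))]
  · simp only [hc]

lemma tau_rec {S : Type*} [Fintype S] (κ : S → S → ℝ) (hκsym : ∀ r s, κ r s = κ s r)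
    (k : S → ℕ) (r : S) (hr : 1 ≤ k r) :
    ((∑ s, (k s : ℝ)) - 1) * tau κ k = ∑ l ∈ Finset.Iic k,
      (∏ s, ((k s - if s = r then 1 else 0).choose (l s) : ℝ)) *
      ((∑ s, (l s : ℝ)) * ((∑ s, κ r s * l s) * tau κ l * tau κ (k - l))) := by
  have h := cnt_compatVec k r
  have : 0 < cnt (compatVec k) Finset.univ r := by rw [h]; omega
  obtain ⟨v, hv⟩ := Finset.card_pos.1 this
  exact tau_rec_gen κ hκsym k r Finset.univ (compatVec k)
    (funext fun s => cnt_compatVec k s) v (Finset.mem_univ v) (Finset.mem_filter.1 hv).2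

lemma rho_rec {S : Type*} [Fintype S] (κ : S → S → ℝ) (hκsym : ∀ r s, κ r s = κ s r)
    (θ : S → ℝ) (k : S → ℕ) (r : S) :
    ((∑ s, (k s : ℝ)) - 1) * (k r * rhoMu κ θ k) = ∑ l ∈ Finset.Iic k,
      ((∑ s, (l s : ℝ)) * (∑ s, κ r s * l s) * rhoMu κ θ l) *
        (((k - l) r : ℕ) * rhoMu κ θ (k - l)) := by
  by_cases hr : 1 ≤ k r
  · unfold rhoMu
    have h := tau_rec κ hκsym k r hr
    calc _ = k r * (∏ s : S, θ s ^ (k s) / (Nat.factorial (k s) : ℝ)) * 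
          (((∑ s, (k s : ℝ)) - 1) * tau κ k) := by ring
      _ = _ := by
        rw [h, Finset.mul_sum]
        refine Finset.sum_congr rfl fun l hl => ?_
        rw [Finset.mem_Iic] at hl
        have key : (k r : ℝ) * (∏ s : S, θ s ^ (k s) / (Nat.factorial (k s) : ℝ)) *
            (∏ s, ((k s - if s = r then 1 else 0).choose (l s) : ℝ)) =
            (((k - l) r : ℕ) : ℝ) * ((∏ s : S, θ s ^ (l s) / (Nat.factorial (l s) : ℝ)) *
            (∏ s : S, θ s ^ ((k - l) s) / (Nat.factorial ((k - l) s) : ℝ))) := by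
          have e1 : (k r : ℝ) = ∏ s, if s = r then (k s : ℝ) else 1 := by simp
          have e2 : (((k - l) r : ℕ) : ℝ) = ∏ s, if s = r then (((k - l) s : ℕ) : ℝ) else 1 := by simp
          rw [e1, e2]
          simp only [← Finset.prod_mul_distrib]
          refine Finset.prod_congr rfl fun s _ => ?_
          have hls := hl s
          obtain ⟨m, hm⟩ := Nat.exists_eq_add_of_le hls
          have hkl : (k - l) s = m := by simp [hm]
          rw [hkl, hm, pow_add]
          have f1 : ((l s).factorial : ℝ) ≠ 0 := by positivity
          have f2 : (m.factorial : ℝ) ≠ 0 := by positivity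
          have f3 : ((l s + m).factorial : ℝ) ≠ 0 := by positivity
          have hch : ((l s + m).choose (l s) : ℝ) * (l s).factorial * m.factorial
              = (l s + m).factorial := by
            have := Nat.add_choose_mul_factorial_mul_factorial (l s) m
            rw [← Nat.choose_symm_add] at this
            exact_mod_cast this
          split_ifs with hsr
          · have hc2 : ((l s + m : ℕ) : ℝ) * ((l s + m - 1).choose (l s) : ℝ) =
                m * ((l s + m).choose (l s) : ℝ) := by
              rcases m with _ | m
              · rcases Nat.eq_zero_or_pos (l s) with h0 | h0
                · simp [h0]
                · rw [Nat.choose_eq_zero_of_lt (by omega)]; simp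
              · have := Nat.add_one_mul_choose_eq (l s + m) (l s)
                have h2 := Nat.choose_mul_succ_eq (l s + m) (l s)
                have e : l s + m + 1 - l s = m + 1 := by omega
                rw [e] at h2
                have e3 : l s + (m + 1) - 1 = l s + m := by omega
                rw [e3]
                have h3 : (l s + (m+1)) * (l s + m).choose (l s) =
                  (m+1) * (l s + (m+1)).choose (l s) := by
                  rw [mul_comm, mul_comm (m+1)]; exact h2
                exact_mod_cast h3
            field_simp
            linear_combination (θ s ^ l s * θ s ^ m * (l s).factorial * m.factorial) * hc2
              + (θ s ^ l s * θ s ^ m * m) * hch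
          · simp only [Nat.sub_zero]
            field_simp
            linear_combination (θ s ^ l s * θ s ^ m) * hch
        linear_combination ((∑ s, (l s : ℝ)) * ((∑ s, κ r s * l s) * tau κ l * tau κ (k - l))) * key
  · have h0 : k r = 0 := by omega
    simp [h0]
def gg {S : Type*} [Fintype S] (κ : S → S → ℝ) (θ : S → ℝ) (r : S) (n : ℕ) : ℝ :=
  ∑ k ∈ Finset.piAntidiag (Finset.univ : Finset S) n, (k r : ℝ) * rhoMu κ θ k

def TT {S : Type*} [Fintype S] (κ : S → S → ℝ) (θ : S → ℝ) (n : ℕ) : ℝ :=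
  ∑ k ∈ Finset.piAntidiag (Finset.univ : Finset S) n, rhoMu κ θ k

lemma mem_PA {S : Type*} [Fintype S] (k : S → ℕ) (n : ℕ) :
    k ∈ Finset.piAntidiag (Finset.univ : Finset S) n ↔ ∑ s, k s = n := by
  simp [Finset.mem_piAntidiag]

lemma conv_PA {S : Type*} [Fintype S] (f h : (S → ℕ) → ℝ) (n : ℕ) :
    ∑ k ∈ Finset.piAntidiag (Finset.univ : Finset S) n, ∑ l ∈ Finset.Iic k, f l * h (k - l) =
    ∑ p ∈ Finset.HasAntidiagonal.antidiagonal n,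
      (∑ l ∈ Finset.piAntidiag (Finset.univ : Finset S) p.1, f l) *
      (∑ l ∈ Finset.piAntidiag (Finset.univ : Finset S) p.2, h l) := by
  simp only [Finset.sum_mul_sum, Finset.sum_sigma']
  refine Finset.sum_bij' (fun p _ => ⟨(∑ s, p.2 s, ∑ s, (p.1 - p.2) s), p.2, p.1 - p.2⟩)
    (fun q _ => ⟨q.2.1 + q.2.2, q.2.1⟩) ?_ ?_ ?_ ?_ ?_
  · rintro ⟨k, l⟩ hp
    simp only [Finset.mem_sigma, mem_PA, Finset.mem_Iic, Finset.HasAntidiagonal.mem_antidiagonal] at hp ⊢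
    refine ⟨?_, trivial, trivial⟩
    rw [← Finset.sum_add_distrib, ← hp.1]
    refine Finset.sum_congr rfl fun s _ => ?_
    have : l s ≤ k s := hp.2 s
    simp only [Pi.sub_apply]; omega
  · rintro ⟨⟨i, j⟩, l, m⟩ hp
    simp only [Finset.mem_sigma, mem_PA, Finset.mem_Iic, Finset.HasAntidiagonal.mem_antidiagonal] at hp ⊢
    refine ⟨?_, by intro s; simp⟩
    simp only [Pi.add_apply, Finset.sum_add_distrib]; omega
  · rintro ⟨k, l⟩ hp
    simp only [Finset.mem_sigma, mem_PA, Finset.mem_Iic] at hp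
    have : l + (k - l) = k := by
      ext s; have : l s ≤ k s := hp.2 s; simp only [Pi.add_apply, Pi.sub_apply]; omega
    simp [this]
  · rintro ⟨⟨i, j⟩, l, m⟩ hp
    simp only [Finset.mem_sigma, mem_PA, Finset.HasAntidiagonal.mem_antidiagonal] at hp
    obtain ⟨h1, rfl, rfl⟩ := hp
    have : l + m - l = m := by
      ext s; simp
    simp [this]
  · rintro ⟨k, l⟩ hp
    rfl

lemma g_rec {S : Type*} [Fintype S] (κ : S → S → ℝ) (hκsym : ∀ r s, κ r s = κ s r)
    (θ : S → ℝ) (r : S) (n : ℕ) :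
    ((n : ℝ) - 1) * gg κ θ r n = ∑ p ∈ Finset.HasAntidiagonal.antidiagonal n,
      (p.1 : ℝ) * (∑ s, κ r s * gg κ θ s p.1) * gg κ θ r p.2 := by
  have h1 : ((n : ℝ) - 1) * gg κ θ r n =
      ∑ k ∈ Finset.piAntidiag (Finset.univ : Finset S) n, ∑ l ∈ Finset.Iic k,
      ((∑ s, (l s : ℝ)) * (∑ s, κ r s * l s) * rhoMu κ θ l) *
        (((k - l) r : ℕ) * rhoMu κ θ (k - l)) := by
    unfold gg
    rw [Finset.mul_sum]
    refine Finset.sum_congr rfl fun k hk => ?_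
    rw [← rho_rec κ hκsym θ k r, ← (mem_PA k n).1 hk]
    push_cast; rfl
  rw [h1, conv_PA (fun l => (∑ s, (l s : ℝ)) * (∑ s, κ r s * l s) * rhoMu κ θ l)
    (fun m => (m r : ℝ) * rhoMu κ θ m)]
  refine Finset.sum_congr rfl fun p _ => ?_
  congr 1
  unfold gg
  simp only [Finset.mul_sum]
  rw [Finset.sum_comm]
  refine Finset.sum_congr rfl fun k hk => ?_
  rw [← (mem_PA k p.1).1 hk]
  push_cast
  rw [Finset.sum_mul]
  refine Finset.sum_congr rfl fun s _ => ?_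
  ring

lemma tau_nonneg {S : Type*} [Fintype S] (κ : S → S → ℝ) (hκ0 : ∀ r s, 0 ≤ κ r s) (k : S → ℕ) :
    0 ≤ tau κ k :=
  Finset.sum_nonneg fun _ _ => Finset.prod_nonneg fun _ _ => hκ0 _ _

lemma rho_nonneg {S : Type*} [Fintype S] (κ : S → S → ℝ) (hκ0 : ∀ r s, 0 ≤ κ r s)
    (θ : S → ℝ) (hθ : ∀ s, 0 ≤ θ s) (k : S → ℕ) : 0 ≤ rhoMu κ θ k :=
  mul_nonneg (tau_nonneg κ hκ0 k) (Finset.prod_nonneg fun s _ => by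
    have := hθ s
    positivity)

lemma treeWeight_one {S : Type*} (n : ℕ) (hn : n = 1) (x : Fin n → S) (κ : S → S → ℝ) :
    treeWeight n x κ = 1 := by
  subst hn
  have hU : upperPairs 1 = ∅ := by
    ext q; simp [upperPairs, Subsingleton.elim q.1 q.2]
  unfold treeWeight
  rw [hU, Finset.powerset_empty, Finset.filter_true_of_mem]
  · simp
  · intro E hE
    rw [Finset.mem_singleton] at hE
    subst hE
    refine ⟨?_, by simp⟩
    refine ⟨fun p q => ?_⟩
    rw [Subsingleton.elim p q]

lemma treeWeight_zero {S : Type*} (n : ℕ) (hn : n = 0) (x : Fin n → S) (κ : S → S → ℝ) :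
    treeWeight n x κ = 0 := by
  subst hn
  unfold treeWeight
  rw [Finset.filter_false_of_mem]
  · simp
  · intro E _ h; omega

lemma gg_one {S : Type*} [Fintype S] (κ : S → S → ℝ) (θ : S → ℝ) (r : S) :
    gg κ θ r 1 = θ r := by
  unfold gg
  rw [Finset.sum_eq_single (Pi.single r 1)]
  · have : tau κ (Pi.single r 1) = 1 := by
      apply treeWeight_one; simp [Finset.sum_pi_single']
    rw [rhoMu, this, Finset.prod_eq_single r]
    · simp
    · intro s _ hs; simp [hs]
    · simp
  · intro k hk hne
    rw [mem_PA] at hk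
    have : k r = 0 := by
      by_contra h0
      apply hne
      have h1 := Finset.add_sum_erase Finset.univ k (Finset.mem_univ r)
      rw [hk] at h1
      have h2 : ∑ s ∈ Finset.univ.erase r, k s = 0 := by omega
      rw [Finset.sum_eq_zero_iff] at h2
      ext s
      by_cases hs : s = r
      · subst hs; simp; omega
      · simp [hs]; exact h2 s (by simp [hs])
    simp [this]
  · intro h
    exact absurd ((mem_PA _ _).2 (by simp [Finset.sum_pi_single'])) h

lemma gg_zero {S : Type*} [Fintype S] (κ : S → S → ℝ) (θ : S → ℝ) (r : S) :
    gg κ θ r 0 = 0 := by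
  unfold gg
  refine Finset.sum_eq_zero fun k hk => ?_
  rw [mem_PA, Finset.sum_eq_zero_iff] at hk
  simp [hk r (Finset.mem_univ r)]

lemma TT_zero {S : Type*} [Fintype S] (κ : S → S → ℝ) (θ : S → ℝ) :
    TT κ θ 0 = 0 := by
  unfold TT
  refine Finset.sum_eq_zero fun k hk => ?_
  rw [mem_PA] at hk
  rw [rhoMu, tau, treeWeight_zero _ hk, zero_mul]

lemma gg_nonneg {S : Type*} [Fintype S] (κ : S → S → ℝ) (hκ0 : ∀ r s, 0 ≤ κ r s)
    (θ : S → ℝ) (hθ : ∀ s, 0 ≤ θ s) (r : S) (n : ℕ) : 0 ≤ gg κ θ r n :=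
  Finset.sum_nonneg fun k _ => mul_nonneg (Nat.cast_nonneg _) (rho_nonneg κ hκ0 θ hθ k)

lemma TT_gg {S : Type*} [Fintype S] (κ : S → S → ℝ) (θ : S → ℝ) (n : ℕ) :
    (n : ℝ) * TT κ θ n = ∑ r, gg κ θ r n := by
  unfold TT gg
  rw [Finset.sum_comm, Finset.mul_sum]
  refine Finset.sum_congr rfl fun k hk => ?_
  rw [← (mem_PA k n).1 hk, ← Finset.sum_mul]
  push_cast; rfl

lemma TT_rec {S : Type*} [Fintype S] (κ : S → S → ℝ) (hκsym : ∀ r s, κ r s = κ s r)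
    (θ : S → ℝ) (n : ℕ) :
    TT κ θ n = ∑ r, gg κ θ r n - (1/2) * ∑ p ∈ Finset.HasAntidiagonal.antidiagonal n,
      ∑ r, ∑ s, gg κ θ r p.1 * κ r s * gg κ θ s p.2 := by
  rcases Nat.eq_zero_or_pos n with rfl | hn
  · simp [TT_zero, gg_zero]
  set B : ℕ × ℕ → ℝ := fun p => ∑ r, ∑ s, gg κ θ r p.1 * κ r s * gg κ θ s p.2 with hB
  have hBs : ∀ p, B p.swap = B p := by
    intro p
    simp only [hB, Prod.fst_swap, Prod.snd_swap]
    rw [Finset.sum_comm]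
    refine Finset.sum_congr rfl fun r _ => Finset.sum_congr rfl fun s _ => ?_
    rw [hκsym r s]; ring
  have h1 : ((n : ℝ) - 1) * ∑ r, gg κ θ r n = ∑ p ∈ Finset.HasAntidiagonal.antidiagonal n, (p.1 : ℝ) * B p := by
    rw [Finset.mul_sum, Finset.sum_congr rfl (fun r _ => g_rec κ hκsym θ r n), Finset.sum_comm]
    refine Finset.sum_congr rfl fun p _ => ?_
    rw [← hBs p]
    simp only [hB, Prod.fst_swap, Prod.snd_swap, Finset.mul_sum, Finset.sum_mul]
    refine Finset.sum_congr rfl fun r _ => Finset.sum_congr rfl fun s _ => ?_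
    ring
  have h2 : ∑ p ∈ Finset.HasAntidiagonal.antidiagonal n, (p.1 : ℝ) * B p =
      ∑ p ∈ Finset.HasAntidiagonal.antidiagonal n, (p.2 : ℝ) * B p := by
    rw [← Finset.Nat.sum_antidiagonal_swap]
    refine Finset.sum_congr rfl fun p _ => ?_
    rw [hBs]; rfl
  have h3 : ∑ p ∈ Finset.HasAntidiagonal.antidiagonal n, (p.1 : ℝ) * B p +
      ∑ p ∈ Finset.HasAntidiagonal.antidiagonal n, (p.2 : ℝ) * B p =
      n * ∑ p ∈ Finset.HasAntidiagonal.antidiagonal n, B p := by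
    rw [← Finset.sum_add_distrib, Finset.mul_sum]
    refine Finset.sum_congr rfl fun p hp => ?_
    rw [← Finset.HasAntidiagonal.mem_antidiagonal.1 hp]
    push_cast; ring
  have h4 := TT_gg κ θ n
  have hn' : (n : ℝ) ≠ 0 := by positivity
  apply mul_left_cancel₀ hn'
  change _ = (n : ℝ) * (_ - 1/2 * ∑ p ∈ Finset.HasAntidiagonal.antidiagonal n, B p)
  linear_combination h4 - h1 - (1/2) * h2 - (1/2) * h3
lemma gron (u v u' v' : ℝ → ℝ) (hu : ∀ x, HasDerivAt u (u' x) x) (hv : ∀ x, HasDerivAt v (v' x) x)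
    (H : ∀ x, 0 ≤ x → x ≤ 1 → u' x ≤ v' x * u x) : u 1 ≤ u 0 * Real.exp (v 1 - v 0) := by
  have hd : ∀ x, HasDerivAt (fun x => u x * Real.exp (- v x))
      (u' x * Real.exp (- v x) + u x * (Real.exp (- v x) * (- v' x))) x := fun x =>
    (hu x).mul ((hv x).neg.exp)
  have ha : AntitoneOn (fun x => u x * Real.exp (- v x)) (Set.Icc 0 1) := by
    refine antitoneOn_of_deriv_nonpos (convex_Icc 0 1)
      (fun x _ => (hd x).continuousAt.continuousWithinAt)
      (fun x _ => (hd x).differentiableAt.differentiableWithinAt) ?_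
    intro x hx
    rw [interior_Icc] at hx
    rw [(hd x).deriv]
    have := H x hx.1.le hx.2.le
    have h2 := Real.exp_pos (- v x)
    nlinarith
  have h := ha (Set.left_mem_Icc.2 zero_le_one) (Set.right_mem_Icc.2 zero_le_one) zero_le_one
  have e1 : u 1 = u 1 * Real.exp (- v 1) * Real.exp (v 1) := by
    rw [mul_assoc, ← Real.exp_add]; simp
  have e2 : Real.exp (v 1 - v 0) = Real.exp (- v 0) * Real.exp (v 1) := by
    rw [← Real.exp_add]; ring_nf
  rw [e1, e2, ← mul_assoc]
  exact mul_le_mul_of_nonneg_right h (Real.exp_pos _).le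

lemma poly_deriv (h : ℕ → ℝ) (M : ℕ) (x : ℝ) :
    HasDerivAt (fun x : ℝ => ∑ n ∈ Finset.range (M+1), h n * x ^ n)
      (∑ n ∈ Finset.range M, ((n : ℝ)+1) * h (n+1) * x ^ n) x := by
  have : HasDerivAt (fun x : ℝ => ∑ n ∈ Finset.range (M+1), h n * x ^ n)
      (∑ n ∈ Finset.range (M+1), h n * ((n : ℝ) * x ^ (n-1))) x := by
    refine HasDerivAt.fun_sum fun n _ => ?_
    exact (hasDerivAt_pow n x).const_mul _
  convert this using 1
  rw [Finset.sum_range_succ']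
  simp only [Nat.cast_zero, zero_mul, mul_zero, add_zero]
  refine Finset.sum_congr rfl fun n _ => ?_
  push_cast
  ring

lemma conv_biU (F : ℕ × ℕ → ℝ) (M : ℕ) :
    ∑ n ∈ Finset.range M, ∑ p ∈ Finset.HasAntidiagonal.antidiagonal n, F p =
    ∑ p ∈ (Finset.range M).biUnion (fun n => Finset.HasAntidiagonal.antidiagonal n), F p := by
  rw [Finset.sum_biUnion]
  intro i _ j _ hij
  rw [Function.onFun, Finset.disjoint_left]
  intro p hp hq
  rw [Finset.HasAntidiagonal.mem_antidiagonal] at hp hq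
  omega

lemma conv_upper (a b : ℕ → ℝ) (ha : ∀ n, 0 ≤ a n) (hb : ∀ n, 0 ≤ b n) (M M' : ℕ) (h : M ≤ M') :
    ∑ n ∈ Finset.range M, ∑ p ∈ Finset.HasAntidiagonal.antidiagonal n, a p.1 * b p.2 ≤
    (∑ n ∈ Finset.range M, a n) * (∑ n ∈ Finset.range M', b n) := by
  rw [conv_biU (fun p => a p.1 * b p.2), Finset.sum_mul_sum, ← Finset.sum_product']
  refine Finset.sum_le_sum_of_subset_of_nonneg ?_ fun p _ _ => mul_nonneg (ha _) (hb _)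
  intro p hp
  simp only [Finset.mem_biUnion, Finset.mem_range, Finset.HasAntidiagonal.mem_antidiagonal,
    Finset.mem_product] at hp ⊢
  obtain ⟨n, hn, e⟩ := hp
  omega

lemma conv_lower (a b : ℕ → ℝ) (ha : ∀ n, 0 ≤ a n) (hb : ∀ n, 0 ≤ b n) (N : ℕ) :
    (∑ n ∈ Finset.range N, a n) * (∑ n ∈ Finset.range N, b n) ≤
    ∑ n ∈ Finset.range (2*N), ∑ p ∈ Finset.HasAntidiagonal.antidiagonal n, a p.1 * b p.2 := by
  rw [conv_biU (fun p => a p.1 * b p.2), Finset.sum_mul_sum, ← Finset.sum_product']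
  refine Finset.sum_le_sum_of_subset_of_nonneg ?_ fun p _ _ => mul_nonneg (ha _) (hb _)
  intro p hp
  simp only [Finset.mem_biUnion, Finset.mem_range, Finset.HasAntidiagonal.mem_antidiagonal,
    Finset.mem_product] at hp ⊢
  exact ⟨p.1 + p.2, by omega, rfl⟩

lemma poly_conv (h q : ℕ → ℝ)
    (rec : ∀ n : ℕ, ((n : ℝ)+1) * h (n+1) = ∑ p ∈ Finset.HasAntidiagonal.antidiagonal n,
      (((p.1 : ℝ)+1) * q (p.1+1)) * h p.2) (M : ℕ) (x : ℝ) :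
    ∑ n ∈ Finset.range M, ((n : ℝ)+1) * h (n+1) * x ^ n =
    ∑ n ∈ Finset.range M, ∑ p ∈ Finset.HasAntidiagonal.antidiagonal n,
      (((p.1 : ℝ)+1) * q (p.1+1) * x ^ p.1) * (h p.2 * x ^ p.2) := by
  refine Finset.sum_congr rfl fun n _ => ?_
  rw [rec, Finset.sum_mul]
  refine Finset.sum_congr rfl fun p hp => ?_
  rw [← Finset.HasAntidiagonal.mem_antidiagonal.1 hp, pow_add]
  ring

lemma lemA (h q : ℕ → ℝ) (h0 : ∀ n, 0 ≤ h n) (q0 : ∀ n, 0 ≤ q n) (qz : q 0 = 0)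
    (rec : ∀ n : ℕ, ((n : ℝ)+1) * h (n+1) = ∑ p ∈ Finset.HasAntidiagonal.antidiagonal n,
      (((p.1 : ℝ)+1) * q (p.1+1)) * h p.2) (M : ℕ) :
    ∑ n ∈ Finset.range (M+1), h n ≤ h 0 * Real.exp (∑ n ∈ Finset.range (M+1), q n) := by
  have := gron _ _ _ _ (poly_deriv h M) (poly_deriv q M) (by
    intro x hx0 hx1
    rw [poly_conv h q rec]
    exact conv_upper (fun n => ((n : ℝ)+1) * q (n+1) * x ^ n) (fun n => h n * x ^ n)
      (fun n => by have := q0 (n+1); positivity)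
      (fun n => by have := h0 n; positivity) M (M+1) (by omega))
  have z : ∀ f : ℕ → ℝ, ∑ n ∈ Finset.range (M+1), f n * (0:ℝ)^n = f 0 := by
    intro f; rw [Finset.sum_range_succ']; simp
  simpa [z, qz] using this

lemma lemB1 (h q : ℕ → ℝ) (h0 : ∀ n, 0 ≤ h n) (q0 : ∀ n, 0 ≤ q n) (qz : q 0 = 0)
    (rec : ∀ n : ℕ, ((n : ℝ)+1) * h (n+1) = ∑ p ∈ Finset.HasAntidiagonal.antidiagonal n,
      (((p.1 : ℝ)+1) * q (p.1+1)) * h p.2) (N : ℕ) :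
    (h 0 - (∑ n ∈ Finset.range (2*N+1), h n - ∑ n ∈ Finset.range N, h n)) *
      Real.exp (∑ n ∈ Finset.range (N+1), q n) ≤ ∑ n ∈ Finset.range N, h n := by
  set ε := ∑ n ∈ Finset.range (2*N+1), h n - ∑ n ∈ Finset.range N, h n with hε
  have := gron _ _ _ _ (fun x => ((poly_deriv h (2*N) x).sub_const ε).neg) (poly_deriv q N) (by
    intro x hx0 hx1
    rw [poly_conv h q rec]
    have l1 := conv_lower (fun n => ((n : ℝ)+1) * q (n+1) * x ^ n) (fun n => h n * x ^ n)
      (fun n => by have := q0 (n+1); positivity)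
      (fun n => by have := h0 n; positivity) N
    have l2 : 0 ≤ ∑ n ∈ Finset.range N, ((n : ℝ)+1) * q (n+1) * x ^ n :=
      Finset.sum_nonneg fun n _ => by have := q0 (n+1); positivity
    have l3 : ∑ n ∈ Finset.range (2*N+1), h n * x ^ n - ∑ n ∈ Finset.range N, h n * x ^ n ≤ ε := by
      have hs : Finset.range N ⊆ Finset.range (2*N+1) := Finset.range_mono (by omega)
      rw [hε, ← Finset.sum_sdiff hs, ← Finset.sum_sdiff hs, add_sub_cancel_right,
        add_sub_cancel_right]
      refine Finset.sum_le_sum fun n _ => ?_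
      exact mul_le_of_le_one_right (h0 n) (pow_le_one₀ hx0 hx1)
    have l4 := mul_le_mul_of_nonneg_left l3 l2
    simp only [Pi.neg_apply]
    linarith)
  have z : ∀ (f : ℕ → ℝ) (M : ℕ), ∑ n ∈ Finset.range (M+1), f n * (0:ℝ)^n = f 0 := by
    intro f M; rw [Finset.sum_range_succ']; simp
  simp only [Pi.neg_apply, z, qz, one_pow, mul_one, sub_zero] at this
  have e : ∑ n ∈ Finset.range (2*N+1), h n - ε = ∑ n ∈ Finset.range N, h n := by rw [hε]; ring
  rw [e] at this
  linarith

lemma lemB (h q : ℕ → ℝ) (h0 : ∀ n, 0 ≤ h n) (q0 : ∀ n, 0 ≤ q n) (qz : q 0 = 0)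
    (rec : ∀ n : ℕ, ((n : ℝ)+1) * h (n+1) = ∑ p ∈ Finset.HasAntidiagonal.antidiagonal n,
      (((p.1 : ℝ)+1) * q (p.1+1)) * h p.2) (H Q : ℝ) (hH : HasSum h H) (hQ : HasSum q Q) :
    H = h 0 * Real.exp Q := by
  have tH := hH.tendsto_sum_nat
  have tQ := hQ.tendsto_sum_nat
  have tQ1 := tQ.comp (tendsto_add_atTop_nat 1)
  have tH1 := tH.comp (tendsto_add_atTop_nat 1)
  have t2 : Tendsto (fun N : ℕ => 2*N+1) atTop atTop :=
    tendsto_atTop_mono (fun n => by simp only [id]; omega) tendsto_id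
  have tH2 := tH.comp t2
  apply le_antisymm
  · exact le_of_tendsto_of_tendsto' tH1 (((Real.continuous_exp.tendsto _).comp tQ1).const_mul (h 0))
      (fun M => lemA h q h0 q0 qz rec M)
  · have := le_of_tendsto_of_tendsto' (((tH2.sub tH).const_sub (h 0)).mul
      ((Real.continuous_exp.tendsto _).comp tQ1)) tH (fun M => lemB1 h q h0 q0 qz rec M)
    simpa using this
lemma hq_rec {S : Type*} [Fintype S] (κ : S → S → ℝ) (hκsym : ∀ r s, κ r s = κ s r)
    (θ : S → ℝ) (r : S) (n : ℕ) :
    ((n : ℝ)+1) * gg κ θ r (n+1+1) = ∑ p ∈ Finset.HasAntidiagonal.antidiagonal n,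
      (((p.1 : ℝ)+1) * (∑ s, κ r s * gg κ θ s (p.1+1))) * gg κ θ r (p.2+1) := by
  have h := g_rec κ hκsym θ r (n+1+1)
  rw [Finset.Nat.sum_antidiagonal_succ, Finset.Nat.sum_antidiagonal_succ'] at h
  simp only [gg_zero, Nat.cast_zero, zero_mul, mul_zero, add_zero, zero_add] at h
  push_cast at h
  rw [← h]; ring

lemma gg_partial {S : Type*} [Fintype S] (κ : S → S → ℝ) (hκsym : ∀ r s, κ r s = κ s r)
    (hκ0 : ∀ r s, 0 ≤ κ r s) (c : S → ℝ) (hc : ∀ s, 0 ≤ c s) (θ : S → ℝ)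
    (hθ : ∀ r, θ r = c r * Real.exp (-(∑ t : S, κ r t * c t))) (N : ℕ) :
    ∀ r, ∑ n ∈ Finset.range (N+1), gg κ θ r n ≤ c r := by
  have hθ0 : ∀ s, 0 ≤ θ s := fun s => by rw [hθ]; exact mul_nonneg (hc s) (Real.exp_pos _).le
  induction N with
  | zero => intro r; simpa [gg_zero] using hc r
  | succ N ih =>
    intro r
    have hA := lemA (fun n => gg κ θ r (n+1)) (fun n => ∑ s, κ r s * gg κ θ s n)
      (fun n => gg_nonneg κ hκ0 θ hθ0 r _)
      (fun n => Finset.sum_nonneg fun s _ => mul_nonneg (hκ0 r s) (gg_nonneg κ hκ0 θ hθ0 s n))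
      (by simp [gg_zero]) (fun n => hq_rec κ hκsym θ r n) N
    rw [Finset.sum_range_succ', gg_zero, add_zero]
    refine hA.trans ?_
    rw [gg_one, hθ r, mul_assoc, ← Real.exp_add]
    refine mul_le_of_le_one_right (hc r) (Real.exp_le_one_iff.2 ?_)
    rw [Finset.sum_comm]
    have : ∑ s, ∑ n ∈ Finset.range (N+1), κ r s * gg κ θ s n ≤ ∑ s, κ r s * c s := by
      refine Finset.sum_le_sum fun s _ => ?_
      rw [← Finset.mul_sum]
      exact mul_le_mul_of_nonneg_left (ih s) (hκ0 r s)
    linarith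

lemma sig_ineq {S : Type*} [Fintype S] (κ : S → S → ℝ) (hκ0 : ∀ r s, 0 ≤ κ r s)
    (c : S → ℝ) (hc : ∀ s, 0 ≤ c s) (hSig : sigmaOp κ c ≤ 1) (f : S → ℝ) (hf : ∀ s, 0 ≤ f s) :
    ∑ r, c r * (∑ s, κ r s * f s * c s)^2 ≤ ∑ r, c r * f r ^ 2 := by
  have hbd : ∀ f : S → ℝ, (∀ s, 0 ≤ f s) → (∑ r : S, c r * f r ^ 2) ≤ 1 →
      Real.sqrt (∑ r : S, c r * (∑ s : S, κ r s * f s * c s) ^ 2) ≤ 1 := by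
    intro f hf hf1
    refine le_trans (le_csSup (s := { t : ℝ | ∃ f : S → ℝ, (∀ s, 0 ≤ f s) ∧ (∑ r : S, c r * f r ^ 2) ≤ 1 ∧
      t = Real.sqrt (∑ r : S, c r * (∑ s : S, κ r s * f s * c s) ^ 2) }) ?_ ⟨f, hf, hf1, rfl⟩) hSig
    refine ⟨Real.sqrt (∑ r : S, c r * (∑ s : S, κ r s * (c s + 1)) ^ 2), ?_⟩
    rintro t ⟨f, hf, hf1, rfl⟩
    refine Real.sqrt_le_sqrt (Finset.sum_le_sum fun r _ => mul_le_mul_of_nonneg_left ?_ (hc r))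
    refine pow_le_pow_left₀ (Finset.sum_nonneg fun s _ =>
      mul_nonneg (mul_nonneg (hκ0 r s) (hf s)) (hc s)) (Finset.sum_le_sum fun s _ => ?_) 2
    rw [mul_assoc]
    refine mul_le_mul_of_nonneg_left ?_ (hκ0 r s)
    have h1 : c s * f s ^ 2 ≤ 1 := le_trans (Finset.single_le_sum
      (f := fun s => c s * f s ^ 2) (fun s _ => mul_nonneg (hc s) (sq_nonneg _))
      (Finset.mem_univ s)) hf1
    have := hc s
    have := mul_nonneg (hc s) (sq_nonneg (f s - 1))
    nlinarith
  set A := ∑ r, c r * f r ^ 2 with hA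
  have hA0 : 0 ≤ A := Finset.sum_nonneg fun s _ => mul_nonneg (hc s) (sq_nonneg _)
  rcases hA0.eq_or_lt with h0 | hpos
  · have hz : ∀ s, f s * c s = 0 := by
      intro s
      have := (Finset.sum_eq_zero_iff_of_nonneg (fun s _ => mul_nonneg (hc s) (sq_nonneg (f s)))).1
        (hA.symm.trans h0.symm) s (Finset.mem_univ s)
      rcases mul_eq_zero.1 this with h | h
      · simp [h]
      · simp [pow_eq_zero_iff] at h; simp [h]
    rw [← h0]
    simp [mul_assoc, hz]
  · have hs : 0 < Real.sqrt A := Real.sqrt_pos.2 hpos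
    have hss : Real.sqrt A ^ 2 = A := Real.sq_sqrt hA0
    have := hbd (fun s => f s / Real.sqrt A) (fun s => div_nonneg (hf s) hs.le) (by
      have : ∑ r, c r * (f r / Real.sqrt A)^2 = A / A := by
        rw [hA, Finset.sum_div, ← hA]
        refine Finset.sum_congr rfl fun s _ => ?_
        rw [div_pow, hss]; ring
      rw [this, div_self hpos.ne'])
    rw [Real.sqrt_le_one] at this
    have e : ∑ r, c r * (∑ s, κ r s * (f s / Real.sqrt A) * c s)^2 =
        (∑ r, c r * (∑ s, κ r s * f s * c s)^2) / A := by
      rw [Finset.sum_div]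
      refine Finset.sum_congr rfl fun r _ => ?_
      have : ∑ s, κ r s * (f s / Real.sqrt A) * c s = (∑ s, κ r s * f s * c s) / Real.sqrt A := by
        rw [Finset.sum_div]
        exact Finset.sum_congr rfl fun s _ => by ring
      rw [this, div_pow, hss]; ring
    rw [e, div_le_one hpos] at this
    exact this

lemma uniq_c {S : Type*} [Fintype S] (κ : S → S → ℝ) (hκ0 : ∀ r s, 0 ≤ κ r s)
    (c : S → ℝ) (hc : ∀ s, 0 ≤ c s) (hSig : sigmaOp κ c ≤ 1) (G : S → ℝ) (hG : ∀ s, G s ≤ c s)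
    (hfix : ∀ r, G r = c r * Real.exp (-(∑ t : S, κ r t * c t)) *
      Real.exp (∑ t : S, κ r t * G t)) : ∀ r, G r = c r := by
  set g : S → ℝ := fun r => ∑ s, κ r s * (c s - G s) with hg
  have hg0 : ∀ r, 0 ≤ g r := fun r => Finset.sum_nonneg fun s _ =>
    mul_nonneg (hκ0 r s) (sub_nonneg.2 (hG s))
  have hGg : ∀ r, G r = c r * Real.exp (- g r) := by
    intro r
    rw [hfix r, mul_assoc, ← Real.exp_add]
    congr 2
    simp only [hg, mul_sub, Finset.sum_sub_distrib]; ring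
  set F : S → ℝ := fun r => 1 - Real.exp (- g r) with hF
  have hF0 : ∀ r, 0 ≤ F r := fun r => by
    simp only [hF, sub_nonneg, Real.exp_le_one_iff]; linarith [hg0 r]
  have hFg : ∀ r, F r ≤ g r := fun r => by
    have := Real.add_one_le_exp (- g r)
    simp only [hF]; linarith
  have hFlt : ∀ r, g r ≠ 0 → F r < g r := fun r h => by
    have := Real.add_one_lt_exp (x := - g r) (by simpa using h)
    simp only [hF]; linarith
  have hgF : ∀ r, g r = ∑ s, κ r s * F s * c s := by
    intro r
    refine Finset.sum_congr rfl fun s _ => ?_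
    rw [hGg s]; simp only [hF]; ring
  have hs := sig_ineq κ hκ0 c hc hSig F hF0
  simp only [← hgF] at hs
  have hle : ∀ r, c r * F r ^ 2 ≤ c r * g r ^ 2 := fun r =>
    mul_le_mul_of_nonneg_left (pow_le_pow_left₀ (hF0 r) (hFg r) 2) (hc r)
  have heq := (Finset.sum_eq_sum_iff_of_le (fun r (_ : r ∈ Finset.univ) => hle r)).1
    (le_antisymm (Finset.sum_le_sum fun r _ => hle r) hs)
  intro r
  rcases (hc r).eq_or_lt with h0 | hpos
  · rw [hGg, ← h0]; simp
  · by_cases hgr : g r = 0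
    · rw [hGg, hgr]; simp
    · have h1 := heq r (Finset.mem_univ r)
      have h2 := pow_lt_pow_left₀ (hFlt r hgr) (hF0 r) two_ne_zero
      exact absurd h1 (mul_lt_mul_of_pos_left h2 hpos).ne

lemma gg_hasSum {S : Type*} [Fintype S] (κ : S → S → ℝ) (hκsym : ∀ r s, κ r s = κ s r)
    (hκ0 : ∀ r s, 0 ≤ κ r s) (c : S → ℝ) (hc : ∀ s, 0 ≤ c s) (hSig : sigmaOp κ c ≤ 1) (θ : S → ℝ)
    (hθ : ∀ r, θ r = c r * Real.exp (-(∑ t : S, κ r t * c t))) (r : S) :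
    HasSum (gg κ θ r) (c r) := by
  have hθ0 : ∀ s, 0 ≤ θ s := fun s => by rw [hθ]; exact mul_nonneg (hc s) (Real.exp_pos _).le
  have hp : ∀ r N, ∑ n ∈ Finset.range N, gg κ θ r n ≤ c r := fun r N =>
    le_trans (Finset.sum_le_sum_of_subset_of_nonneg (Finset.range_mono (Nat.le_succ N))
      fun n _ _ => gg_nonneg κ hκ0 θ hθ0 r n) (gg_partial κ hκsym hκ0 c hc θ hθ N r)
  have hsum : ∀ r, Summable (gg κ θ r) := fun r =>
    summable_of_sum_range_le (gg_nonneg κ hκ0 θ hθ0 r) (hp r)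
  have key := uniq_c κ hκ0 c hc hSig (fun r => ∑' n, gg κ θ r n)
    (fun r => (hsum r).tsum_le_of_sum_range_le (hp r)) (by
      intro r
      have hH : HasSum (fun n => gg κ θ r (n+1)) (∑' n, gg κ θ r n) := by
        have := (hasSum_nat_add_iff' 1).2 (hsum r).hasSum
        simpa [gg_zero] using this
      have := lemB (fun n => gg κ θ r (n+1)) (fun n => ∑ s, κ r s * gg κ θ s n)
        (fun n => gg_nonneg κ hκ0 θ hθ0 r _)
        (fun n => Finset.sum_nonneg fun s _ => mul_nonneg (hκ0 r s) (gg_nonneg κ hκ0 θ hθ0 s n))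
        (by simp [gg_zero]) (fun n => hq_rec κ hκsym θ r n) _ _ hH
        (hasSum_sum fun s _ => (hsum s).hasSum.mul_left (κ r s))
      rw [zero_add, gg_one, hθ r] at this
      exact this)
  rw [← key r]
  exact (hsum r).hasSum

lemma TT_hasSum {S : Type*} [Fintype S] (κ : S → S → ℝ) (hκsym : ∀ r s, κ r s = κ s r)
    (hκ0 : ∀ r s, 0 ≤ κ r s) (c : S → ℝ) (hc : ∀ s, 0 ≤ c s) (hSig : sigmaOp κ c ≤ 1) (θ : S → ℝ)
    (hθ : ∀ r, θ r = c r * Real.exp (-(∑ t : S, κ r t * c t))) :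
    HasSum (TT κ θ) ((∑ r : S, c r) - (1/2) * ∑ r : S, ∑ s : S, c r * κ r s * c s) := by
  have hG := gg_hasSum κ hκsym hκ0 c hc hSig θ hθ
  have hC : ∀ r s, HasSum (fun n => ∑ p ∈ Finset.HasAntidiagonal.antidiagonal n,
      gg κ θ r p.1 * gg κ θ s p.2) (c r * c s) := by
    intro r s
    have n1 := (hG r).summable.norm
    have n2 := (hG s).summable.norm
    have e := tsum_mul_tsum_eq_tsum_sum_antidiagonal_of_summable_norm n1 n2
    rw [(hG r).tsum_eq, (hG s).tsum_eq] at e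
    rw [e]
    exact (summable_norm_sum_mul_antidiagonal_of_summable_norm n1 n2).of_norm.hasSum
  have h := (hasSum_sum (s := Finset.univ) fun r _ => hG r).sub
    ((hasSum_sum (s := Finset.univ) fun r _ => hasSum_sum (s := Finset.univ) fun s _ =>
      (hC r s).mul_left (κ r s)).mul_left (1/2))
  have e1 : TT κ θ = fun n => ∑ i, gg κ θ i n - 1 / 2 * ∑ i, ∑ j, κ i j *
      ∑ p ∈ Finset.HasAntidiagonal.antidiagonal n, gg κ θ i p.1 * gg κ θ j p.2 := by
    ext n
    rw [TT_rec κ hκsym θ n]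
    congr 2
    rw [Finset.sum_comm]
    refine Finset.sum_congr rfl fun r _ => ?_
    rw [Finset.sum_comm]
    refine Finset.sum_congr rfl fun s _ => ?_
    rw [Finset.mul_sum]
    refine Finset.sum_congr rfl fun p _ => ?_
    ring
  have e2 : ∑ r : S, ∑ s : S, c r * κ r s * c s = ∑ r, ∑ s, κ r s * (c r * c s) := by
    refine Finset.sum_congr rfl fun r _ => Finset.sum_congr rfl fun s _ => ?_
    ring
  rw [e1, e2]
  exact h

lemma rho_hasSum {S : Type*} [Fintype S] (f : (S → ℕ) → ℝ) (hf : ∀ k, 0 ≤ f k) (a : ℝ)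
    (h : HasSum (fun n => ∑ k ∈ Finset.piAntidiag (Finset.univ : Finset S) n, f k) a) :
    HasSum f a := by
  have hs : Summable f := by
    refine summable_of_sum_le hf (c := a) fun u => ?_
    refine le_trans ?_ (sum_le_hasSum (u.image fun k => ∑ s, k s)
      (fun n _ => Finset.sum_nonneg fun k _ => hf k) h)
    rw [← Finset.sum_fiberwise_of_maps_to (s := u) (t := u.image fun k => ∑ s, k s)
      (g := fun k => ∑ s, k s) (fun k hk => Finset.mem_image_of_mem _ hk)]
    refine Finset.sum_le_sum fun n _ => Finset.sum_le_sum_of_subset_of_nonneg ?_ fun k _ _ => hf k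
    intro k hk
    rw [mem_PA]
    exact (Finset.mem_filter.1 hk).2
  have h2 := hs.hasSum.tsum_fiberwise (fun k => ∑ s, k s)
  have e : (fun n => ∑' b : ((fun k : S → ℕ => ∑ s, k s) ⁻¹' {n}), f b) =
      fun n => ∑ k ∈ Finset.piAntidiag (Finset.univ : Finset S) n, f k := by
    ext n
    rw [← Finset.tsum_subtype]
    have : ((fun k : S → ℕ => ∑ s, k s) ⁻¹' {n}) =
      ((Finset.piAntidiag (Finset.univ : Finset S) n : Finset (S → ℕ)) : Set (S → ℕ)) := by
      ext k; simp [mem_PA]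
    rw [this]; rfl
  rw [e] at h2
  rw [h.unique h2]
  exact hs.hasSum
/-- total mass of the minimizer `λ(c)`. -/
theorem lamC_total_mass
    {S : Type*} [Fintype S] [DecidableEq S] [Nonempty S]
    (κ : S → S → ℝ) (hκsym : ∀ r s, κ r s = κ s r) (hκ0 : ∀ r s, 0 ≤ κ r s)
    (c : S → ℝ) (hc : ∀ s, 0 ≤ c s) (hSig : sigmaOp κ c ≤ 1) :
    HasSum (fun k : S → ℕ => lamC κ c k)
      ((∑ r : S, c r) - (1/2) * ∑ r : S, ∑ s : S, c r * κ r s * c s) := by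
  have hθ0 : ∀ s, 0 ≤ c s * Real.exp (-(∑ t : S, κ s t * c t)) := fun s =>
    mul_nonneg (hc s) (Real.exp_pos _).le
  exact rho_hasSum (rhoMu κ (fun s => c s * Real.exp (-(∑ t : S, κ s t * c t))))
    (rho_nonneg κ hκ0 _ hθ0) _ (TT_hasSum κ hκsym hκ0 c hc hSig _ (fun r => rfl))


end
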